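/- Let G₊ := {x ∈ ℝⁿ : x₁x₂ = 0, x₁ ≥ 0, x₂ ≥ 0} and G₋ := {x ∈ ℝⁿ : x₁x₂ = 0, x₁ ≤ 0, x₂ ≤ 0}. If H₁ and H₂ are topoplanes belonging to an arrangement of topoplanes 𝓗 in ℝⁿ, and H₁ ∩ H₂ ≠ ∅ but H₁ and H₂ do not cross, then there exists a homeomorphism e of ℝⁿ onto itself with e(H₁) = G₊ and e(H₂) = G₋ (and hence e(H₁ ∩ H₂) = {x : x₁ = x₂ = 0}). -/

import Mathlib

open Set

/-- The `i`-th coordinate hyperplane in `ℝⁿ` (by convention the whole space if `i ≥ n`). -/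
def coordHyp (n i : ℕ) : Set (Fin n → ℝ) := {x | ∀ h : i < n, x ⟨i, h⟩ = 0}

/-- `H` is a topological hyperplane (topoplane) in `ℝⁿ`: some self-homeomorphism of `ℝⁿ`
carries `H` onto the coordinate hyperplane `{x | x₁ = 0}`. -/
def IsTopoplane {n : ℕ} (H : Set (Fin n → ℝ)) : Prop :=
  ∃ e : (Fin n → ℝ) ≃ₜ (Fin n → ℝ), e '' H = coordHyp n 0

/-- `Z` is a relative topoplane in `Y ⊆ ℝⁿ`: `Z ⊆ Y` and some homeomorphism of `Y`
(with the subspace topology) onto some `ℝᵈ`, `d ≥ 1`, carries `Z` onto `{x | x₁ = 0}`. -/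
def IsRelTopoplane {n : ℕ} (Y Z : Set (Fin n → ℝ)) : Prop :=
  Z ⊆ Y ∧ ∃ d : ℕ, 1 ≤ d ∧ ∃ φ : Y ≃ₜ (Fin d → ℝ),
    φ '' {y : Y | (y : Fin n → ℝ) ∈ Z} = coordHyp d 0

/-- `Y` is a flat of the family `𝓗`: a nonempty intersection of a subfamily of `𝓗`
(the empty intersection being all of `ℝⁿ`). -/
def IsFlat {n : ℕ} (𝓗 : Set (Set (Fin n → ℝ))) (Y : Set (Fin n → ℝ)) : Prop :=
  (∃ 𝓢 ⊆ 𝓗, Y = ⋂₀ 𝓢) ∧ Y.Nonempty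

/-- `𝓗` is an arrangement of topoplanes in `ℝⁿ`: a finite set of topoplanes such that for
every `H ∈ 𝓗` and every flat `Y`, either `Y ⊆ H`, or `H ∩ Y = ∅`, or `H ∩ Y` is a
relative topoplane in `Y`. -/
def IsArrangement {n : ℕ} (𝓗 : Set (Set (Fin n → ℝ))) : Prop :=
  𝓗.Finite ∧ (∀ H ∈ 𝓗, IsTopoplane H) ∧
    ∀ H ∈ 𝓗, ∀ Y : Set (Fin n → ℝ), IsFlat 𝓗 Y →
      Y ⊆ H ∨ H ∩ Y = ∅ ∨ IsRelTopoplane Y (H ∩ Y)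

/-- `Y` has dimension `d`: it is homeomorphic, in the subspace topology, to `ℝᵈ`. -/
def HasDim {n : ℕ} (Y : Set (Fin n → ℝ)) (d : ℕ) : Prop :=
  Nonempty (Y ≃ₜ (Fin d → ℝ))

/-- Topoplanes `H₁`, `H₂` cross: some self-homeomorphism of `ℝⁿ` carries them
simultaneously onto the coordinate hyperplanes `{x | x₁ = 0}` and `{x | x₂ = 0}`. -/
def Crosses {n : ℕ} (H₁ H₂ : Set (Fin n → ℝ)) : Prop :=
  ∃ e : (Fin n → ℝ) ≃ₜ (Fin n → ℝ), e '' H₁ = coordHyp n 0 ∧ e '' H₂ = coordHyp n 1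

/-- The pairwise condition for an arrangement to be affine: any two distinct members
are disjoint or cross. -/
def PairwiseAffine {n : ℕ} (𝓗 : Set (Set (Fin n → ℝ))) : Prop :=
  ∀ H₁ ∈ 𝓗, ∀ H₂ ∈ 𝓗, H₁ ≠ H₂ → H₁ ∩ H₂ = ∅ ∨ Crosses H₁ H₂

/-- `G₊ = {x ∈ ℝⁿ : x₁x₂ = 0, x₁ ≥ 0, x₂ ≥ 0}` (empty if `n < 2`). -/
def Gplus (n : ℕ) : Set (Fin n → ℝ) :=
  {x | ∃ h : 1 < n, x ⟨0, by omega⟩ * x ⟨1, h⟩ = 0 ∧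
    0 ≤ x ⟨0, by omega⟩ ∧ 0 ≤ x ⟨1, h⟩}

/-- `G₋ = {x ∈ ℝⁿ : x₁x₂ = 0, x₁ ≤ 0, x₂ ≤ 0}` (empty if `n < 2`). -/
def Gminus (n : ℕ) : Set (Fin n → ℝ) :=
  {x | ∃ h : 1 < n, x ⟨0, by omega⟩ * x ⟨1, h⟩ = 0 ∧
    x ⟨0, by omega⟩ ≤ 0 ∧ x ⟨1, h⟩ ≤ 0}

open MeasureTheory Filter Topology
open Complex (I)

section InvarianceOfDimension

variable {E : Type*} [NormedAddCommGroup E] [InnerProductSpace ℝ E] [FiniteDimensional ℝ E]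

lemma exists_polynomial_det (A : E →L[ℝ] E) :
    ∃ p : Polynomial ℝ, p.natDegree ≤ Module.finrank ℝ E ∧
      ∀ t : ℝ, p.eval t = (ContinuousLinearMap.id ℝ E + t • A).det := by
  classical
  let b := Module.finBasis ℝ E
  let M : Matrix (Fin (Module.finrank ℝ E)) (Fin (Module.finrank ℝ E)) ℝ :=
    LinearMap.toMatrix b b (A : E →ₗ[ℝ] E)
  refine ⟨((Polynomial.X : Polynomial ℝ) • M.map Polynomial.C
    + (1 : Matrix (Fin (Module.finrank ℝ E)) (Fin (Module.finrank ℝ E)) ℝ).map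
      Polynomial.C).det, ?_, fun t => ?_⟩
  · simpa using Polynomial.natDegree_det_X_add_C_le M 1
  · rw [ContinuousLinearMap.det, ← LinearMap.det_toMatrix b]
    rw [← Polynomial.coe_evalRingHom, RingHom.map_det]
    congr 1
    ext i j
    by_cases hij : i = j
    · subst hij; simp [M, LinearMap.toMatrix_apply]; ring
    · simp [M, LinearMap.toMatrix_apply, hij]; ring

lemma exists_polynomial_weight (k : ℕ) (x v : E) (A : E →L[ℝ] E) :
    ∃ p : Polynomial ℝ, p.natDegree ≤ 2 * k + Module.finrank ℝ E ∧
      ∀ t : ℝ, p.eval t =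
        (1 - ‖x + t • v‖ ^ 2 / 4) ^ k * (ContinuousLinearMap.id ℝ E + t • A).det := by
  obtain ⟨q, hq, hqe⟩ := exists_polynomial_det A
  let r : Polynomial ℝ := Polynomial.C (-‖v‖ ^ 2 / 4) * Polynomial.X ^ 2 +
    Polynomial.C (-inner ℝ x v / 2) * Polynomial.X + Polynomial.C (1 - ‖x‖ ^ 2 / 4)
  have hr : r.natDegree ≤ 2 := Polynomial.natDegree_quadratic_le
  refine ⟨r ^ k * q, ?_, fun t => ?_⟩
  · refine Polynomial.natDegree_mul_le.trans (add_le_add ?_ hq)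
    refine Polynomial.natDegree_pow_le.trans ?_
    nlinarith
  · have h : r.eval t = 1 - ‖x + t • v‖ ^ 2 / 4 := by
      rw [norm_add_sq_real, norm_smul, inner_smul_right, mul_pow, Real.norm_eq_abs, sq_abs]
      simp only [r, Polynomial.eval_add, Polynomial.eval_mul, Polynomial.eval_C,
        Polynomial.eval_pow, Polynomial.eval_X]
      ring
    rw [Polynomial.eval_mul, Polynomial.eval_pow, h, hqe]

/-- A family of polynomials of bounded degree whose integral is constant near zero has constant
integral. -/
lemma integral_eval_one_eq {X : Type*} [MeasurableSpace X] {μ : Measure X} (p : X → Polynomial ℝ)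
    (N : ℕ) (hp : ∀ x, (p x).natDegree ≤ N) {ε c : ℝ} (hε : 0 < ε)
    (hint : ∀ t : ℝ, 0 < t → t < ε → Integrable (fun x => (p x).eval t) μ)
    (hc : ∀ t : ℝ, 0 < t → t < ε → ∫ x, (p x).eval t ∂μ = c) :
    ∫ x, (p x).eval 1 ∂μ = c := by
  let node : ℕ → ℝ := fun j => ε / (j + 2)
  have hpos : ∀ j, 0 < node j := fun j => by positivity
  have hlt : ∀ j, node j < ε := fun j => by
    rw [div_lt_iff₀ (by positivity)]
    have : (0 : ℝ) ≤ j := j.cast_nonneg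
    nlinarith
  have hinj : Set.InjOn node (Finset.range (N + 1)) := by
    intro i _ j _ hij
    have : (ε / (i + 2) : ℝ) = ε / (j + 2) := hij
    rw [div_eq_div_iff (by positivity) (by positivity)] at this
    have := mul_left_cancel₀ hε.ne' this
    exact_mod_cast (by linarith : (i : ℝ) = j)
  have key : ∀ q : Polynomial ℝ, q.natDegree ≤ N → q.eval 1 = ∑ j ∈ Finset.range (N + 1),
      q.eval (node j) * (Lagrange.basis (Finset.range (N + 1)) node j).eval 1 := by
    intro q hq
    have hd : q.degree < ((Finset.range (N + 1)).card : WithBot ℕ) := by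
      rw [Finset.card_range]
      exact lt_of_le_of_lt Polynomial.degree_le_natDegree (by exact_mod_cast Nat.lt_succ_of_le hq)
    conv_lhs => rw [Lagrange.eq_interpolate hinj hd, Lagrange.interpolate_apply]
    simp [Polynomial.eval_finsetSum]
  have h1 : ∑ j ∈ Finset.range (N + 1),
      (Lagrange.basis (Finset.range (N + 1)) node j).eval 1 = 1 := by
    have := key 1 (by simp)
    simpa using this.symm
  calc ∫ x, (p x).eval 1 ∂μ = ∫ x, ∑ j ∈ Finset.range (N + 1),
      (p x).eval (node j) * (Lagrange.basis (Finset.range (N + 1)) node j).eval 1 ∂μ := by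
        congr 1; ext x; exact key _ (hp x)
    _ = ∑ j ∈ Finset.range (N + 1),
        c * (Lagrange.basis (Finset.range (N + 1)) node j).eval 1 := by
      rw [integral_finsetSum _ fun j _ => (hint _ (hpos j) (hlt j)).mul_const _]
      refine Finset.sum_congr rfl fun j _ => ?_
      rw [integral_mul_const, hc _ (hpos j) (hlt j)]
    _ = c := by rw [← Finset.mul_sum, h1, mul_one]

lemma det_id_add_pos {A : E →L[ℝ] E} (hA : ‖A‖ < 1) :
    0 < (ContinuousLinearMap.id ℝ E + A).det := by
  have hne : ∀ s ∈ Icc (0 : ℝ) 1, (ContinuousLinearMap.id ℝ E + s • A).det ≠ 0 := by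
    intro s hs h0
    obtain ⟨x, hx, hx0⟩ : ∃ x, x ≠ 0 ∧ x + s • A x = 0 := by
      have := LinearMap.bot_lt_ker_of_det_eq_zero
        (f := ((ContinuousLinearMap.id ℝ E + s • A : E →L[ℝ] E) : E →ₗ[ℝ] E)) h0
      obtain ⟨x, hx, hx0⟩ := (Submodule.ne_bot_iff _).1 this.ne'
      exact ⟨x, hx0, by simpa using hx⟩
    have h1 : ‖x‖ ≤ ‖A‖ * ‖x‖ := by
      have : x = -(s • A x) := eq_neg_of_add_eq_zero_left hx0
      calc ‖x‖ = s * ‖A x‖ := by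
            conv_lhs => rw [this]
            rw [norm_neg, norm_smul, Real.norm_of_nonneg hs.1]
        _ ≤ 1 * ‖A x‖ := by gcongr; exact hs.2
        _ ≤ ‖A‖ * ‖x‖ := by rw [one_mul]; exact A.le_opNorm x
    have : 0 < ‖x‖ := norm_pos_iff.2 hx
    nlinarith
  have hcont : ContinuousOn (fun s : ℝ => (ContinuousLinearMap.id ℝ E + s • A).det) (Icc 0 1) := by
    have : Continuous fun s : ℝ => (ContinuousLinearMap.id ℝ E + s • A).det :=
      ContinuousLinearMap.continuous_det.comp (by fun_prop)
    exact this.continuousOn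
  by_contra hneg
  push Not at hneg
  have h0 : (ContinuousLinearMap.id ℝ E + (0 : ℝ) • A).det = 1 := by
    simp [ContinuousLinearMap.det]
  have := intermediate_value_Icc' zero_le_one hcont
  obtain ⟨s, hs, hs0⟩ := this ⟨by simpa using hneg, by rw [h0]; exact zero_le_one⟩
  exact hne s hs hs0

/-- A smooth map that is the identity off a ball has a zero: the no-retraction theorem. -/
lemma exists_zero_of_eq_id_off_ball {G : E → E} (hG : ContDiff ℝ 1 G)
    (hG0 : ∀ x, 2 ≤ ‖x‖ → G x = 0) (hball : ∀ x, ‖x‖ ≤ 2 → ‖x + G x‖ ≤ 2) :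
    ∃ x, x + G x = 0 := by
  by_contra! hne
  let _ : MeasurableSpace E := borel E
  have : BorelSpace E := ⟨rfl⟩
  let B : Set E := Metric.closedBall 0 2
  have hBc : IsCompact B := isCompact_closedBall _ _
  have hGc : HasCompactSupport G := HasCompactSupport.intro hBc fun x hx => hG0 x (by
    simp only [B, Metric.mem_closedBall, dist_zero_right, not_le] at hx; exact hx.le)
  obtain ⟨K, hK⟩ := hG.lipschitzWith_of_hasCompactSupport hGc one_ne_zero
  have hDG : ∀ x, ‖fderiv ℝ G x‖ ≤ K := fun x => norm_fderiv_le_of_lipschitz ℝ hK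
  have hDc : Continuous (fderiv ℝ G) := hG.continuous_fderiv one_ne_zero
  have hGcont := hG.continuous
  have hF' : ∀ (t : ℝ) x, HasFDerivAt (fun x => x + t • G x)
      (ContinuousLinearMap.id ℝ E + t • fderiv ℝ G x) x := fun t x =>
    (hasFDerivAt_id x).add (((hG.differentiable one_ne_zero) x).hasFDerivAt.const_smul t)
  have hdetc : ∀ t : ℝ, Continuous fun x => (ContinuousLinearMap.id ℝ E + t • fderiv ℝ G x).det :=
    fun t => ContinuousLinearMap.continuous_det.comp (by fun_prop)
  let ε : ℝ := 1 / (K + 1)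
  have hε : 0 < ε := by positivity
  have hsmall : ∀ t : ℝ, 0 < t → t < ε → t * K < 1 := by
    intro t ht hte
    rw [lt_div_iff₀ (by positivity)] at hte
    nlinarith
  have hbij : ∀ t : ℝ, 0 < t → t < ε → Function.Bijective (fun x => x + t • G x) := by
    intro t ht hte
    rcases subsingleton_or_nontrivial E with hE | hE
    · exact ⟨fun _ _ _ => Subsingleton.elim _ _, fun y => ⟨y, Subsingleton.elim _ _⟩⟩
    have happ : ApproximatesLinearOn (fun x => x + t • G x)
        ((ContinuousLinearEquiv.refl ℝ E : E ≃L[ℝ] E) : E →L[ℝ] E) univ (t.toNNReal * K) := by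
      intro x _ y _
      have : x + t • G x - (y + t • G y) - ((ContinuousLinearEquiv.refl ℝ E : E ≃L[ℝ] E) :
          E →L[ℝ] E) (x - y) = t • (G x - G y) := by
        simp [smul_sub]; abel
      rw [this, norm_smul, Real.norm_of_nonneg ht.le]
      have := hK.dist_le_mul x y
      rw [dist_eq_norm, dist_eq_norm] at this
      simp only [NNReal.coe_mul, Real.coe_toNNReal _ ht.le]
      nlinarith
    have hc : t.toNNReal * K < ‖((ContinuousLinearEquiv.refl ℝ E).symm : E →L[ℝ] E)‖₊⁻¹ := by
      have h1 : ‖((ContinuousLinearEquiv.refl ℝ E).symm : E →L[ℝ] E)‖₊ = 1 := by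
        ext; simp
      rw [h1, inv_one, ← NNReal.coe_lt_coe]
      simpa [Real.coe_toNNReal _ ht.le] using hsmall t ht hte
    exact ⟨(happ.antilipschitz (Or.inr hc)).injective.comp
      (fun _ _ h => congrArg Subtype.val h :
        Function.Injective fun x : E => (⟨x, mem_univ x⟩ : univ)), happ.surjective (Or.inr hc)⟩
  have himage : ∀ t : ℝ, 0 < t → t < ε → (fun x => x + t • G x) '' B = B := by
    intro t ht hte
    have hout : ∀ x, x ∉ B → x + t • G x = x := fun x hx => by
      simp only [B, Metric.mem_closedBall, dist_zero_right, not_le] at hx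
      simp [hG0 x hx.le]
    have hte1 : t ≤ 1 := by
      refine hte.le.trans ?_
      rw [div_le_one (by positivity)]
      have : (0 : ℝ) ≤ K := K.2
      linarith
    ext y
    constructor
    · rintro ⟨x, hx, rfl⟩
      have hx' : ‖x‖ ≤ 2 := by simpa [B] using hx
      have : x + t • G x = (1 - t) • x + t • (x + G x) := by module
      simp only [B, Metric.mem_closedBall, dist_zero_right]
      rw [this]
      refine (norm_add_le _ _).trans ?_
      rw [norm_smul, norm_smul, Real.norm_of_nonneg ht.le, Real.norm_of_nonneg (by linarith)]
      have := hball x hx'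
      nlinarith
    · intro hy
      obtain ⟨x, hx⟩ := (hbij t ht hte).2 y
      refine ⟨x, ?_, hx⟩
      by_contra hxB
      exact hxB (by rw [← hout x hxB]; simpa [hx] using hy)
  have hid : ∀ k : ℕ, ∫ x in B, (1 - ‖x + G x‖ ^ 2 / 4) ^ k *
      (ContinuousLinearMap.id ℝ E + fderiv ℝ G x).det = ∫ x in B, (1 - ‖x‖ ^ 2 / 4) ^ k := by
    intro k
    choose p hpd hpe using fun x => exists_polynomial_weight k x (G x) (fderiv ℝ G x)
    have := integral_eval_one_eq (μ := volume.restrict B) p _ hpd hε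
      (c := ∫ x in B, (1 - ‖x‖ ^ 2 / 4) ^ k) ?_ ?_
    · rw [← this]
      simp [hpe]
    · intro t _ _
      simp_rw [hpe]
      have := hdetc t
      exact ContinuousOn.integrableOn_compact hBc (by fun_prop)
    · intro t ht hte
      conv_rhs => rw [← himage t ht hte]
      rw [integral_image_eq_integral_abs_det_fderiv_smul volume hBc.measurableSet
        (fun x _ => (hF' t x).hasFDerivWithinAt) (hbij t ht hte).1.injOn]
      congr 1
      ext x
      have hpos : 0 < (ContinuousLinearMap.id ℝ E + t • fderiv ℝ G x).det := by
        refine det_id_add_pos (lt_of_le_of_lt ?_ (hsmall t ht hte))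
        rw [norm_smul, Real.norm_of_nonneg ht.le]
        exact mul_le_mul_of_nonneg_left (hDG x) ht.le
      rw [hpe, abs_of_pos hpos, smul_eq_mul, mul_comm]
  obtain ⟨η, hη, hη2, hηF⟩ : ∃ η : ℝ, 0 < η ∧ η ≤ 2 ∧ ∀ x ∈ B, η ≤ ‖x + G x‖ := by
    obtain ⟨x₀, hx₀, hmin⟩ := hBc.exists_isMinOn (f := fun x => ‖x + G x‖)
      ⟨0, by simp [B]⟩ (by fun_prop)
    exact ⟨‖x₀ + G x₀‖, norm_pos_iff.2 (hne x₀), hball _ (by simpa [B] using hx₀), hmin⟩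
  obtain ⟨C, hC⟩ := hBc.exists_bound_of_continuousOn
    (f := fun x => (ContinuousLinearMap.id ℝ E + fderiv ℝ G x).det)
    (by simpa using (hdetc 1).continuousOn)
  let V := volume.real B
  let v := volume.real (Metric.closedBall (0 : E) (η / 2))
  have hv : 0 < v := by
    refine ENNReal.toReal_pos (Metric.measure_closedBall_pos _ _ (by positivity)).ne'
      (isCompact_closedBall _ _).measure_lt_top.ne
  have hup : ∀ k : ℕ, |∫ x in B, (1 - ‖x + G x‖ ^ 2 / 4) ^ k *
      (ContinuousLinearMap.id ℝ E + fderiv ℝ G x).det| ≤ (1 - η ^ 2 / 4) ^ k * C * V := by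
    intro k
    rw [← Real.norm_eq_abs]
    refine norm_setIntegral_le_of_norm_le_const hBc.measure_lt_top fun x hx => ?_
    have h2 : ‖x + G x‖ ≤ 2 := hball x (by simpa [B] using hx)
    have h1 := hηF x hx
    rw [norm_mul, norm_pow]
    have h3 : 0 ≤ 1 - ‖x + G x‖ ^ 2 / 4 := by nlinarith [norm_nonneg (x + G x)]
    have h4 : 1 - ‖x + G x‖ ^ 2 / 4 ≤ 1 - η ^ 2 / 4 := by nlinarith [norm_nonneg (x + G x)]
    rw [Real.norm_of_nonneg h3]
    exact mul_le_mul (pow_le_pow_left₀ h3 h4 k) (hC x hx) (norm_nonneg _)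
      (pow_nonneg (h3.trans h4) k)
  have hlow : ∀ k : ℕ, (1 - η ^ 2 / 16) ^ k * v ≤ ∫ x in B, (1 - ‖x‖ ^ 2 / 4) ^ k := by
    intro k
    have hsub : Metric.closedBall (0 : E) (η / 2) ⊆ B :=
      Metric.closedBall_subset_closedBall (by linarith)
    have hint : IntegrableOn (fun x : E => (1 - ‖x‖ ^ 2 / 4) ^ k) B :=
      ContinuousOn.integrableOn_compact hBc (by fun_prop)
    calc (1 - η ^ 2 / 16) ^ k * v
        ≤ ∫ x in Metric.closedBall (0 : E) (η / 2), (1 - ‖x‖ ^ 2 / 4) ^ k := by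
          have := setIntegral_mono_on (μ := volume) (s := Metric.closedBall (0 : E) (η / 2))
            (f := fun _ => (1 - η ^ 2 / 16) ^ k) (g := fun x : E => (1 - ‖x‖ ^ 2 / 4) ^ k)
            (by rw [integrableOn_const_iff]; exact Or.inr (isCompact_closedBall _ _).measure_lt_top)
            (hint.mono_set hsub)
            measurableSet_closedBall ?_
          · simpa [v, mul_comm] using this
          · intro x hx
            have hx' : ‖x‖ ≤ η / 2 := by simpa using hx
            exact pow_le_pow_left₀ (by nlinarith) (by nlinarith [norm_nonneg x]) k
      _ ≤ _ := by
          refine setIntegral_mono_set hint ?_ hsub.eventuallyLE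
          rw [EventuallyLE, ae_restrict_iff' hBc.measurableSet]
          refine Eventually.of_forall fun x hx => pow_nonneg ?_ k
          have hx' : ‖x‖ ≤ 2 := by simpa [B] using hx
          nlinarith [norm_nonneg x]
  have hcmp : ∀ k : ℕ, v / (|C| * V + 1) ≤ ((1 - η ^ 2 / 4) / (1 - η ^ 2 / 16)) ^ k := by
    intro k
    have h1 := (hlow k).trans (((hid k).symm.trans_le (le_abs_self _)).trans (hup k))
    have hV : 0 ≤ V := measureReal_nonneg
    have ha : 0 ≤ (1 - η ^ 2 / 4) := by nlinarith
    have hb : 0 < (1 - η ^ 2 / 16) := by nlinarith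
    rw [div_pow, div_le_div_iff₀ (by positivity) (by positivity)]
    have h2 : (1 - η ^ 2 / 4) ^ k * C * V ≤ (1 - η ^ 2 / 4) ^ k * (|C| * V + 1) := by
      rw [mul_assoc]
      gcongr
      nlinarith [le_abs_self C]
    linarith
  have htend : Tendsto (fun k : ℕ => ((1 - η ^ 2 / 4) / (1 - η ^ 2 / 16)) ^ k) atTop (𝓝 0) := by
    have ha : 0 ≤ (1 - η ^ 2 / 4) := by nlinarith
    have hb : 0 < (1 - η ^ 2 / 16) := by nlinarith
    refine tendsto_pow_atTop_nhds_zero_of_lt_one (by positivity) ?_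
    rw [div_lt_one hb]
    nlinarith
  have hV : 0 ≤ V := measureReal_nonneg
  have := ge_of_tendsto' htend hcmp
  have : 0 < v / (|C| * V + 1) := by positivity
  linarith

/-- A continuous self-map of a Euclidean space that is uniformly close to the identity vanishes
somewhere. -/
lemma exists_zero_of_dist_id_lt {v : E → E} (hv : Continuous v) (hd : ∀ x, ‖v x - x‖ < 3 / 8) :
    ∃ x, v x = 0 := by
  by_contra! hne
  obtain ⟨w, hw, hwv, -⟩ := hv.exists_contDiff_approx (ε := fun x => min (1 / 8) ‖v x‖) 1
    (by fun_prop) fun x => lt_min (by norm_num) (norm_pos_iff.2 (hne x))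
  have hw0 : ∀ x, w x ≠ 0 := fun x h0 => by
    have := (hwv x).trans_le (min_le_right _ _)
    rw [h0, dist_zero_left] at this
    exact lt_irrefl _ this
  have hwd : ∀ x, ‖w x - x‖ < 1 / 2 := fun x => by
    have h1 := (hwv x).trans_le (min_le_left _ _)
    rw [dist_eq_norm] at h1
    calc ‖w x - x‖ = ‖(w x - v x) + (v x - x)‖ := by congr 1; abel
      _ ≤ _ := norm_add_le _ _
      _ < 1 / 2 := by linarith [hd x]
  let χ : ContDiffBump (0 : E) := ⟨1, 3 / 2, one_pos, by norm_num⟩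
  have hχ : ∀ x, 0 ≤ χ x ∧ χ x ≤ 1 := fun x => ⟨χ.nonneg, χ.le_one⟩
  obtain ⟨x, hx⟩ := exists_zero_of_eq_id_off_ball (G := fun x => χ x • (w x - x))
    (by
      have := χ.contDiff (n := 1)
      have := hw.of_le (m := 1) (by simp)
      fun_prop)
    (fun x hx => by
      have : χ x = 0 := χ.zero_of_le_dist (by simp [χ]; linarith)
      simp [this])
    (fun x hx => by
      rcases le_or_gt (3 / 2) ‖x‖ with h | h
      · have : χ x = 0 := χ.zero_of_le_dist (by simpa [χ] using h)
        simpa [this] using hx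
      · refine (norm_add_le _ _).trans ?_
        rw [norm_smul, Real.norm_of_nonneg (hχ x).1]
        nlinarith [hχ x, hwd x, norm_nonneg (w x - x)])
  rcases le_or_gt ‖x‖ 1 with h | h
  · have : χ x = 1 := χ.one_of_mem_closedBall (by simpa [χ] using h)
    rw [this, one_smul] at hx
    exact hw0 x (by simpa using hx)
  · have h1 : ‖x‖ = ‖χ x • (w x - x)‖ := by
      rw [eq_neg_of_add_eq_zero_left hx, norm_neg, ← eq_neg_of_add_eq_zero_left hx]
    rw [norm_smul, Real.norm_of_nonneg (hχ x).1] at h1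
    nlinarith [hχ x, hwd x, norm_nonneg (w x - x)]

lemma finrank_le_of_homeomorph {F : Type*} [NormedAddCommGroup F] [InnerProductSpace ℝ F]
    [FiniteDimensional ℝ F] (f : F ≃ₜ E) : Module.finrank ℝ F ≤ Module.finrank ℝ E := by
  by_contra! hlt
  obtain ⟨P, hP, hPg, -⟩ := f.symm.continuous.exists_contDiff_approx (ε := fun _ => 1 / 4) 1
    continuous_const fun _ => by norm_num
  have hP1 : ContDiff ℝ 1 P := hP.of_le (by simp)
  obtain ⟨y, hy, hyd⟩ := (hP1.dense_compl_range_of_finrank_lt_finrank hlt).exists_dist_lt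
    (0 : F) (ε := 1 / 8) (by norm_num)
  obtain ⟨x, hx⟩ := exists_zero_of_dist_id_lt (v := fun x => P (f x) - y)
    ((hP1.continuous.comp f.continuous).sub continuous_const) fun x => by
      have h1 := hPg (f x)
      rw [f.symm_apply_apply, dist_eq_norm] at h1
      rw [dist_zero_left] at hyd
      calc ‖P (f x) - y - x‖ = ‖(P (f x) - x) - y‖ := by congr 1; abel
        _ ≤ ‖P (f x) - x‖ + ‖y‖ := norm_sub_le _ _
        _ < 3 / 8 := by linarith
  exact hy ⟨f x, by simpa [sub_eq_zero] using hx⟩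

/-- Invariance of dimension. -/
theorem eq_of_homeomorph_fin_fun {a b : ℕ} (f : (Fin a → ℝ) ≃ₜ (Fin b → ℝ)) : a = b := by
  let g : EuclideanSpace ℝ (Fin a) ≃ₜ EuclideanSpace ℝ (Fin b) :=
    (EuclideanSpace.equiv (Fin a) ℝ).toHomeomorph.trans
      (f.trans (EuclideanSpace.equiv (Fin b) ℝ).symm.toHomeomorph)
  have h1 := finrank_le_of_homeomorph g
  have h2 := finrank_le_of_homeomorph g.symm
  simp only [finrank_euclideanSpace, Fintype.card_fin] at h1 h2
  exact le_antisymm h1 h2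

end InvarianceOfDimension

section RadialGauge

/-- The increasing homeomorphism of the line attached to a sequence decreasing to zero: it takes
the `j`-th term of the sequence to about `1 / (j + 1)`. -/
lemma exists_orderIso_of_seq {ρ : ℕ → ℝ} (hρ0 : ∀ j, 0 < ρ j) (hρ : ∀ j, ρ (j + 1) < ρ j)
    (hρ1 : ∀ j : ℕ, ρ j ≤ 1 / ((j + 1) * (j + 2))) :
    ∃ g : ℝ ≃o ℝ, g 0 = 0 ∧ ∀ j : ℕ, 1 / (j + 2) ≤ g (ρ j) ∧ g (ρ j) ≤ 1 / (j + 1) := by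
  have hanti : StrictAnti ρ := strictAnti_nat_of_succ_lt hρ
  let clamp : ℝ → ℝ := fun t => max 0 (min 1 t)
  have hc0 : ∀ t, 0 ≤ clamp t := fun t => le_max_left _ _
  have hc1 : ∀ t, clamp t ≤ 1 := fun t => max_le zero_le_one (min_le_left _ _)
  have hcm : Monotone clamp := fun s t h => max_le_max le_rfl (min_le_min le_rfl h)
  let a : ℕ → ℝ := fun j => 1 / (j + 2) - 1 / (j + 3)
  have ha : ∀ j, 0 ≤ a j := fun j => by
    have : (1 : ℝ) / (j + 3) ≤ 1 / (j + 2) := by gcongr; norm_num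
    simp only [a]; linarith
  have htail : ∀ J : ℕ, HasSum (fun j => if J ≤ j then a j else 0) (1 / (J + 2) : ℝ) := by
    intro J
    rw [hasSum_iff_tendsto_nat_of_nonneg (fun j => by split_ifs; exacts [ha j, le_rfl])]
    let c : ℕ → ℝ := fun j => 1 / ((max j J : ℕ) + 2)
    have hs : ∀ N, ∑ j ∈ Finset.range N, (if J ≤ j then a j else 0) = c 0 - c N := by
      intro N
      rw [← Finset.sum_range_sub']
      refine Finset.sum_congr rfl fun j _ => ?_
      split_ifs with h
      · simp only [a, c, max_eq_left h, max_eq_left (h.trans j.le_succ)]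
        push_cast; ring
      · simp only [c, max_eq_right (not_le.1 h).le, max_eq_right (Nat.succ_le_of_lt (not_le.1 h))]
        ring
    simp_rw [hs]
    have hc : Tendsto c atTop (𝓝 0) := by
      have h1 : Tendsto (fun j : ℕ => (1 : ℝ) / ((j : ℝ) + 2)) atTop (𝓝 0) := by
        have : Tendsto (fun j : ℕ => (j : ℝ) + 2) atTop atTop :=
          tendsto_atTop_add_const_right _ _ tendsto_natCast_atTop_atTop
        simp only [one_div]
        exact this.inv_tendsto_atTop
      refine squeeze_zero (fun j => by positivity) (fun j => ?_) h1
      simp only [c]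
      gcongr
      exact_mod_cast le_max_left j J
    simpa [c] using tendsto_const_nhds.sub hc
  have hasum : Summable a := by simpa using (htail 0).summable
  let term : ℕ → ℝ → ℝ := fun j r => a j * clamp ((r - ρ (j + 1)) / (ρ j - ρ (j + 1)))
  have hterm : ∀ j r, ‖term j r‖ ≤ a j := fun j r => by
    rw [Real.norm_of_nonneg (mul_nonneg (ha j) (hc0 _))]
    exact mul_le_of_le_one_right (ha j) (hc1 _)
  have hterm0 : ∀ j r, 0 ≤ term j r := fun j r => mul_nonneg (ha j) (hc0 _)
  have hsum : ∀ r, Summable fun j => term j r := fun r =>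
    Summable.of_norm_bounded hasum fun j => hterm j r
  let S : ℝ → ℝ := fun r => ∑' j, term j r
  have hS0 : ∀ r, 0 ≤ S r := fun r => tsum_nonneg fun j => hterm0 j r
  have hScont : Continuous S := continuous_tsum (fun j => by fun_prop) hasum hterm
  have hSmono : Monotone S := fun r s h => by
    refine (hsum r).tsum_le_tsum (fun j => ?_) (hsum s)
    refine mul_le_mul_of_nonneg_left (hcm ?_) (ha j)
    have := sub_pos.2 (hρ j)
    gcongr
  have hSle : ∀ r, S r ≤ 1 / 2 := fun r => by
    have h1 : HasSum a (1 / 2) := by simpa using htail 0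
    refine hasSum_le (fun j => ?_) (hsum r).hasSum h1
    exact (Real.le_norm_self _).trans (hterm j r)
  have hSneg : S 0 = 0 := by
    have : ∀ j, term j 0 = 0 := fun j => by
      have h1 : (0 - ρ (j + 1)) / (ρ j - ρ (j + 1)) ≤ 0 :=
        div_nonpos_of_nonpos_of_nonneg (by linarith [hρ0 (j + 1)]) (sub_pos.2 (hρ j)).le
      have h2 : clamp ((0 - ρ (j + 1)) / (ρ j - ρ (j + 1))) = 0 :=
        max_eq_left ((min_le_right _ _).trans h1)
      simp only [term]
      rw [h2, mul_zero]
    simp [S, this]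
  have hSρ : ∀ J : ℕ, S (ρ J) = 1 / (J + 2) := fun J => by
    rw [← (htail J).tsum_eq]
    refine tsum_congr fun j => ?_
    have hd := sub_pos.2 (hρ j)
    split_ifs with h
    · have h1 : 1 ≤ (ρ J - ρ (j + 1)) / (ρ j - ρ (j + 1)) := by
        rw [le_div_iff₀ hd]
        linarith [hanti.antitone h]
      simp [term, clamp, min_eq_left h1]
    · have h1 : (ρ J - ρ (j + 1)) / (ρ j - ρ (j + 1)) ≤ 0 :=
        div_nonpos_of_nonpos_of_nonneg
          (by linarith [hanti.antitone (Nat.succ_le_of_lt (not_le.1 h))]) hd.le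
      have h2 : clamp ((ρ J - ρ (j + 1)) / (ρ j - ρ (j + 1))) = 0 :=
        max_eq_left ((min_le_right _ _).trans h1)
      simp only [term]
      rw [h2, mul_zero]
  have hstrict : StrictMono fun r => r + S r := fun r s h =>
    add_lt_add_of_lt_of_le h (hSmono h.le)
  have hsurj : Function.Surjective fun r => r + S r := by
    refine Continuous.surjective (by fun_prop) ?_ ?_
    · exact tendsto_atTop_mono (fun r => le_add_of_nonneg_right (hS0 r)) tendsto_id
    · exact tendsto_atBot_mono (fun r => add_le_add le_rfl (hSle r))
        (tendsto_atBot_add_const_right _ _ tendsto_id)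
  refine ⟨hstrict.orderIsoOfSurjective _ hsurj, by simp [hSneg], fun j => ?_⟩
  have h1 : (1 : ℝ) / (j + 1) = 1 / (j + 2) + 1 / ((j + 1) * (j + 2)) := by field_simp; ring
  simp only [StrictMono.coe_orderIsoOfSurjective, hSρ]
  exact ⟨by linarith [hρ0 j], by linarith [hρ1 j]⟩

variable {E : Type*} [NormedAddCommGroup E]

lemma exists_forall_norm_snd_lt [ProperSpace E] {f : E × ℂ → E × ℂ} (hf : Continuous f)
    (hf0 : ∀ e, f (e, 0) = (e, 0)) (R : ℝ) {ε : ℝ} (hε : 0 < ε) :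
    ∃ δ > 0, ∀ e c, ‖e‖ ≤ R → ‖c‖ ≤ δ → ‖(f (e, c)).2‖ < ε ∧ ‖(f (e, c)).1 - e‖ ≤ 1 := by
  have hK : IsCompact (Metric.closedBall (0 : E) R) := isCompact_closedBall _ _
  have hopen : IsOpen {p : ℂ × E | ‖(f (p.2, p.1)).2‖ < ε ∧ ‖(f (p.2, p.1)).1 - p.2‖ < 1} := by
    have h : Continuous fun p : ℂ × E => f (p.2, p.1) := hf.comp (by fun_prop)
    exact (isOpen_lt h.snd.norm continuous_const).inter
      (isOpen_lt (h.fst.sub continuous_snd).norm continuous_const)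
  obtain ⟨u, v, hu, hv, h0u, hKv, huv⟩ := generalized_tube_lemma (isCompact_singleton (x := (0 : ℂ)))
    hK hopen (by
      rintro ⟨c, e⟩ ⟨hc, -⟩
      obtain rfl : c = 0 := hc
      simp [hf0, hε])
  obtain ⟨δ, hδ, hball⟩ := Metric.isOpen_iff.1 hu 0 (h0u rfl)
  refine ⟨δ / 2, by positivity, fun e c he hc => ?_⟩
  have := huv (show (c, e) ∈ u ×ˢ v from ⟨hball (by simp; linarith), hKv (by simpa using he)⟩)
  exact ⟨this.1, this.2.le⟩

/-- `f` changes the reciprocal of the radial coordinate, measured by `g`, by a locally bounded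
amount near `E × {0}`. -/
def RadiallyTame (g : ℝ ≃o ℝ) (f : E × ℂ → E × ℂ) : Prop :=
  ∀ e₀ : E, ∃ δ > 0, ∃ B : ℝ, ∀ e c, ‖e - e₀‖ < δ → 0 < ‖c‖ → ‖c‖ < δ →
    |1 / g ‖(f (e, c)).2‖ - 1 / g ‖c‖| ≤ B

lemma radiallyTame_of_seq {ρ : ℕ → ℝ} (hρ0 : ∀ j, 0 < ρ j) (hρ : ∀ j, ρ (j + 1) < ρ j)
    (hρ1 : ∀ j : ℕ, ρ j ≤ 1 / ((j + 1) * (j + 2))) {g : ℝ ≃o ℝ}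
    (hg : ∀ j : ℕ, 1 / (j + 2) ≤ g (ρ j) ∧ g (ρ j) ≤ 1 / (j + 1)) {f f' : E × ℂ → E × ℂ}
    (hf'f : ∀ p, f' (f p) = p)
    (hf : ∀ (j : ℕ) (e : E) (c : ℂ), ‖e‖ ≤ j → ‖c‖ ≤ ρ (j + 1) →
      ‖(f (e, c)).2‖ < ρ j ∧ ‖(f (e, c)).1 - e‖ ≤ 1)
    (hf' : ∀ (j : ℕ) (e : E) (c : ℂ), ‖e‖ ≤ j → ‖c‖ ≤ ρ (j + 1) →
      ‖(f' (e, c)).2‖ < ρ j ∧ ‖(f' (e, c)).1 - e‖ ≤ 1) :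
    RadiallyTame g f := by
  have hanti : StrictAnti ρ := strictAnti_nat_of_succ_lt hρ
  intro e₀
  obtain ⟨J₀, hJ₀⟩ := exists_nat_ge (‖e₀‖ + 3)
  refine ⟨min 1 (ρ (J₀ + 2)), lt_min one_pos (hρ0 _), 4, fun e c he hc0 hc => ?_⟩
  have he1 : ‖e‖ ≤ J₀ := by
    have h1 := he.trans_le (min_le_left _ _)
    have h2 := norm_sub_norm_le e e₀
    linarith
  obtain ⟨J, hJ, hJ1, hJ2⟩ : ∃ J, J₀ + 1 ≤ J ∧ ρ (J + 1) < ‖c‖ ∧ ‖c‖ ≤ ρ J := by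
    have hex : ∃ k, ρ k < ‖c‖ := by
      obtain ⟨k, hk⟩ := exists_nat_one_div_lt hc0
      refine ⟨k, lt_of_le_of_lt ((hρ1 k).trans ?_) hk⟩
      have : (0 : ℝ) ≤ k := k.cast_nonneg
      gcongr
      nlinarith
    classical
    have h1 := Nat.find_spec hex
    have h2 : J₀ + 2 < Nat.find hex := by
      by_contra! h
      exact absurd h1 (not_lt.2 ((hc.le.trans (min_le_right _ _)).trans (hanti.antitone h)))
    obtain ⟨k, hk⟩ : ∃ k, Nat.find hex = k + 1 := ⟨Nat.find hex - 1, by omega⟩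
    refine ⟨k, by omega, hk ▸ h1, not_lt.1 (Nat.find_min hex (by omega))⟩
  obtain ⟨K, rfl⟩ : ∃ K, J = K + 1 := ⟨J - 1, by omega⟩
  have heK : ‖e‖ ≤ K := he1.trans (by exact_mod_cast (by omega : J₀ ≤ K))
  obtain ⟨hlt, hfst⟩ := hf K e c heK hJ2
  have hgt : ρ (K + 3) < ‖(f (e, c)).2‖ := by
    by_contra! h
    have hn : ‖(f (e, c)).1‖ ≤ ((K + 2 : ℕ) : ℝ) := by
      have := norm_sub_norm_le (f (e, c)).1 e
      push_cast
      linarith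
    have := (hf' (K + 2) _ _ hn h).1
    rw [Prod.mk.eta, hf'f] at this
    exact absurd this (not_lt.2 hJ1.le)
  have a1 : 1 / (K + 5 : ℝ) ≤ g ‖(f (e, c)).2‖ := by
    refine le_trans (le_of_eq ?_) ((hg (K + 3)).1.trans (g.monotone hgt.le))
    push_cast; ring
  have a2 : g ‖(f (e, c)).2‖ ≤ 1 / (K + 1 : ℝ) := (g.monotone hlt.le).trans (hg K).2
  have a3 : 1 / (K + 4 : ℝ) ≤ g ‖c‖ := by
    refine le_trans (le_of_eq ?_) ((hg (K + 2)).1.trans (g.monotone hJ1.le))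
    push_cast; ring
  have a4 : g ‖c‖ ≤ 1 / (K + 2 : ℝ) := by
    refine ((g.monotone hJ2).trans (hg (K + 1)).2).trans (le_of_eq ?_)
    push_cast; ring
  have hK : (0 : ℝ) ≤ K := K.cast_nonneg
  have pos1 : 0 < g ‖(f (e, c)).2‖ := lt_of_lt_of_le (by positivity) a1
  have pos2 : 0 < g ‖c‖ := lt_of_lt_of_le (by positivity) a3
  have b1 := one_div_le_one_div_of_le (by positivity) a1
  have b2 := one_div_le_one_div_of_le pos1 a2
  have b3 := one_div_le_one_div_of_le (by positivity) a3
  have b4 := one_div_le_one_div_of_le pos2 a4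
  rw [one_div_one_div] at b1 b2 b3 b4
  rw [abs_le]
  constructor <;> linarith

lemma exists_radial_gauge [ProperSpace E] (Ψ : (E × ℂ) ≃ₜ (E × ℂ)) (hΨ : ∀ e, Ψ (e, 0) = (e, 0)) :
    ∃ g : ℝ ≃o ℝ, g 0 = 0 ∧ RadiallyTame g Ψ ∧ RadiallyTame g Ψ.symm := by
  have hΨ' : ∀ e, Ψ.symm (e, 0) = (e, 0) := fun e => by rw [Ψ.symm_apply_eq, hΨ]
  have step : ∀ (j : ℕ) (r : {r : ℝ // 0 < r}), ∃ r' : {r : ℝ // 0 < r}, r'.1 < r.1 ∧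
      r'.1 ≤ 1 / ((j + 2) * (j + 3)) ∧ ∀ e c, ‖e‖ ≤ j → ‖c‖ ≤ r'.1 →
        (‖(Ψ (e, c)).2‖ < r.1 ∧ ‖(Ψ (e, c)).1 - e‖ ≤ 1) ∧
        (‖(Ψ.symm (e, c)).2‖ < r.1 ∧ ‖(Ψ.symm (e, c)).1 - e‖ ≤ 1) := by
    rintro j ⟨r, hr⟩
    obtain ⟨δ₁, hδ₁, h1⟩ := exists_forall_norm_snd_lt Ψ.continuous hΨ j hr
    obtain ⟨δ₂, hδ₂, h2⟩ := exists_forall_norm_snd_lt Ψ.symm.continuous hΨ' j hr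
    refine ⟨⟨min (min δ₁ δ₂) (min (r / 2) (1 / ((j + 2) * (j + 3)))), by positivity⟩, ?_, ?_, ?_⟩
    · exact lt_of_le_of_lt ((min_le_right _ _).trans (min_le_left _ _)) (by linarith)
    · exact (min_le_right _ _).trans (min_le_right _ _)
    · intro e c he hc
      exact ⟨h1 e c he (hc.trans ((min_le_left _ _).trans (min_le_left _ _))),
        h2 e c he (hc.trans ((min_le_left _ _).trans (min_le_right _ _)))⟩
  choose next hnext1 hnext2 hnext3 using step
  let ρ : ℕ → {r : ℝ // 0 < r} := fun j => Nat.rec ⟨1 / 2, by norm_num⟩ next j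
  have hρ0 : ∀ j, 0 < (ρ j).1 := fun j => (ρ j).2
  have hρ : ∀ j, (ρ (j + 1)).1 < (ρ j).1 := fun j => hnext1 j (ρ j)
  have hρ1 : ∀ j : ℕ, (ρ j).1 ≤ 1 / ((j + 1) * (j + 2)) := by
    rintro (_ | j)
    · simp [ρ]
    · refine (hnext2 j (ρ j)).trans (le_of_eq ?_)
      push_cast; ring
  obtain ⟨g, hg0, hg⟩ := exists_orderIso_of_seq hρ0 hρ hρ1
  exact ⟨g, hg0,
    radiallyTame_of_seq hρ0 hρ hρ1 hg Ψ.symm_apply_apply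
      (fun j e c he hc => (hnext3 j (ρ j) e c he hc).1)
      (fun j e c he hc => (hnext3 j (ρ j) e c he hc).2),
    radiallyTame_of_seq hρ0 hρ hρ1 hg Ψ.apply_symm_apply
      (fun j e c he hc => (hnext3 j (ρ j) e c he hc).2)
      (fun j e c he hc => (hnext3 j (ρ j) e c he hc).1)⟩

end RadialGauge

section LogarithmicLift

lemma exists_int_forall_eq_add {Y : Type*} [TopologicalSpace Y] [PreconnectedSpace Y] [Nonempty Y]
    {a b : Y → ℂ} (ha : Continuous a) (hb : Continuous b)
    (hab : ∀ y, Complex.exp (a y) = Complex.exp (b y)) :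
    ∃ n : ℤ, ∀ y, a y = b y + n * (2 * Real.pi * I) := by
  obtain ⟨y₀⟩ := ‹Nonempty Y›
  obtain ⟨n, hn⟩ := Complex.exp_eq_exp_iff_exists_int.1 (hab y₀)
  refine ⟨n, fun y => ?_⟩
  refine congrFun (Complex.isCoveringMap_exp.eq_of_comp_eq ha
    (hb.add continuous_const : Continuous fun y => b y + n * (2 * Real.pi * I)) ?_ y₀ hn) y
  ext y
  simp [hab, Complex.exp_add, Complex.exp_int_mul_two_pi_mul_I]

variable {E : Type*} [NormedAddCommGroup E] [NormedSpace ℝ E]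

lemma exists_continuous_log {f : E × ℂ → ℂ} (hf : Continuous f) (h0 : ∀ p, f p ≠ 0) :
    ∃ L : E × ℂ → ℂ, Continuous L ∧ ∀ p, Complex.exp (L p) = f p := by
  have hU : IsSimplyConnected (univ : Set (E × ℂ)) := by
    have := (Homeomorph.Set.univ (E × ℂ)).contractibleSpace
    exact SimplyConnectedSpace.ofContractible _
  obtain ⟨L, hL, hLe⟩ := Complex.exists_continuousOn_eqOn_exp_comp hU isOpen_univ hf.continuousOn
    (by rintro ⟨p, -, hp⟩; exact h0 p hp)
  exact ⟨L, continuousOn_univ.1 hL, fun p => hLe (mem_univ p)⟩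

lemma snd_homeomorph_ne_zero {E : Type*} [TopologicalSpace E] {Ψ : (E × ℂ) ≃ₜ (E × ℂ)}
    (hΨ : ∀ e, Ψ (e, 0) = (e, 0)) {e : E} {c : ℂ} (hc : c ≠ 0) : (Ψ (e, c)).2 ≠ 0 := by
  intro h
  have : Ψ (e, c) = Ψ ((Ψ (e, c)).1, 0) := by rw [hΨ]; exact Prod.ext rfl h
  exact hc (congrArg Prod.snd (Ψ.injective this))

/-- `Φ` is a lift of `Ψ` along the fibrewise exponential map `(e, w) ↦ (e, exp w)`. -/
def IsExpLift {E : Type*} (Ψ Φ : E × ℂ → E × ℂ) : Prop :=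
  ∀ e w, (Φ (e, w)).1 = (Ψ (e, Complex.exp w)).1 ∧
    Complex.exp (Φ (e, w)).2 = (Ψ (e, Complex.exp w)).2

lemma exists_continuous_isExpLift {Ψ : (E × ℂ) ≃ₜ (E × ℂ)} (hΨ : ∀ e, Ψ (e, 0) = (e, 0)) :
    ∃ Φ : E × ℂ → E × ℂ, Continuous Φ ∧ IsExpLift Ψ Φ := by
  have hc : Continuous fun p : E × ℂ => Ψ (p.1, Complex.exp p.2) := by fun_prop
  obtain ⟨L, hL, hLe⟩ := exists_continuous_log hc.snd fun p =>
    snd_homeomorph_ne_zero hΨ (Complex.exp_ne_zero p.2)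
  exact ⟨fun p => ((Ψ (p.1, Complex.exp p.2)).1, L p), hc.fst.prodMk hL,
    fun e w => ⟨rfl, hLe (e, w)⟩⟩

/-- The deck transformation by `n` turns. -/
noncomputable def deckShift (E : Type*) [TopologicalSpace E] (n : ℤ) : (E × ℂ) ≃ₜ (E × ℂ) where
  toFun p := (p.1, p.2 + n * (2 * Real.pi * I))
  invFun p := (p.1, p.2 - n * (2 * Real.pi * I))
  left_inv p := by simp
  right_inv p := by simp
  continuous_toFun := by fun_prop
  continuous_invFun := by fun_prop

lemma IsExpLift.exists_comp_eq_deckShift {Ψ Ψ' Φ Φ' : E × ℂ → E × ℂ} (hΦ : IsExpLift Ψ Φ)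
    (hΦ' : IsExpLift Ψ' Φ') (hc : Continuous Φ) (hc' : Continuous Φ')
    (hΨ : ∀ p, Ψ' (Ψ p) = p) : ∃ n : ℤ, ∀ p, Φ' (Φ p) = deckShift E n p := by
  have h : ∀ p, (Φ' (Φ p)).1 = p.1 ∧ Complex.exp (Φ' (Φ p)).2 = Complex.exp p.2 := by
    rintro ⟨e, w⟩
    have h1 := hΦ e w
    have h2 := hΦ' (Φ (e, w)).1 (Φ (e, w)).2
    have h3 : ((Φ (e, w)).1, (Ψ (e, Complex.exp w)).2) = Ψ (e, Complex.exp w) :=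
      Prod.ext h1.1 rfl
    rwa [h1.2, h3, hΨ] at h2
  obtain ⟨n, hn⟩ := exists_int_forall_eq_add (hc'.comp hc).snd continuous_snd fun p => (h p).2
  exact ⟨n, fun p => Prod.ext (h p).1 (hn p)⟩

lemma exists_homeomorph_isExpLift {Ψ : (E × ℂ) ≃ₜ (E × ℂ)} (hΨ : ∀ e, Ψ (e, 0) = (e, 0)) :
    ∃ Φ : (E × ℂ) ≃ₜ (E × ℂ), IsExpLift Ψ Φ ∧ IsExpLift Ψ.symm Φ.symm := by
  have hΨ' : ∀ e, Ψ.symm (e, 0) = (e, 0) := fun e => by rw [Ψ.symm_apply_eq, hΨ]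
  obtain ⟨Φ, hc, hΦ⟩ := exists_continuous_isExpLift hΨ
  obtain ⟨Φ', hc', hΦ'⟩ := exists_continuous_isExpLift hΨ'
  obtain ⟨n, hn⟩ := hΦ.exists_comp_eq_deckShift hΦ' hc hc' Ψ.symm_apply_apply
  obtain ⟨m, hm⟩ := hΦ'.exists_comp_eq_deckShift hΦ hc' hc Ψ.apply_symm_apply
  have hleft : ∀ p, (deckShift E n).symm (Φ' (Φ p)) = p := fun p => by simp [hn]
  have hright : ∀ p, Φ ((deckShift E n).symm (Φ' p)) = p := fun p => by
    have h1 : ∀ q, Φ (Φ' ((deckShift E m).symm q)) = q := fun q => by simp [hm]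
    have h2 : Φ (Φ' ((deckShift E m).symm p)) = p := h1 p
    have h3 := hleft (Φ' ((deckShift E m).symm p))
    rw [h2] at h3
    rw [h3, h2]
  refine ⟨⟨⟨Φ, fun p => (deckShift E n).symm (Φ' p), hleft, hright⟩, hc,
    (deckShift E n).symm.continuous.comp hc'⟩, hΦ, fun e w => ?_⟩
  have := hΦ' e w
  refine ⟨this.1, ?_⟩
  change Complex.exp ((Φ' (e, w)).2 - n * (2 * Real.pi * I)) = _
  rw [Complex.exp_sub, Complex.exp_int_mul_two_pi_mul_I, div_one, this.2]

lemma IsExpLift.exists_apply_deckShift {Ψ Φ : E × ℂ → E × ℂ} (hΦ : IsExpLift Ψ Φ)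
    (hc : Continuous Φ) (k : ℤ) : ∃ n : ℤ, ∀ p, Φ (deckShift E k p) = deckShift E n (Φ p) := by
  have h : ∀ p, (Φ (deckShift E k p)).1 = (Φ p).1 ∧
      Complex.exp (Φ (deckShift E k p)).2 = Complex.exp (Φ p).2 := by
    rintro ⟨e, w⟩
    have h1 := hΦ e w
    have h2 := hΦ e (w + k * (2 * Real.pi * I))
    rw [Complex.exp_add, Complex.exp_int_mul_two_pi_mul_I, mul_one] at h2
    exact ⟨h2.1.trans h1.1.symm, h2.2.trans h1.2.symm⟩
  obtain ⟨n, hn⟩ := exists_int_forall_eq_add (hc.comp (deckShift E k).continuous).snd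
    hc.snd fun p => (h p).2
  exact ⟨n, fun p => Prod.ext (h p).1 (hn p)⟩

lemma deckShift_iterate_eq {E : Type*} [TopologicalSpace E] {Φ : E × ℂ → E × ℂ} {n : ℤ}
    (h : ∀ p, Φ (deckShift E 1 p) = deckShift E n (Φ p)) (k : ℤ) (p : E × ℂ) :
    Φ (deckShift E k p) = deckShift E (n * k) (Φ p) := by
  have hadd : ∀ a b : ℤ, ∀ q, deckShift E (a + b) q = deckShift E a (deckShift E b q) := by
    intro a b q
    refine Prod.ext rfl ?_
    simp only [deckShift, Homeomorph.homeomorph_mk_coe, Equiv.coe_fn_mk]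
    push_cast; ring
  have hzero : ∀ q, deckShift E 0 q = q := fun q => by simp [deckShift]
  induction k with
  | zero => simp [hzero]
  | succ k ih => rw [add_comm, hadd, h, ih, ← hadd]; congr 2; ring
  | pred k ih =>
    apply (deckShift E n).injective
    rw [← h, ← hadd, ← hadd, show (1 + (-(k : ℤ) - 1)) = -k by ring, ih]
    congr 2; ring

/-- Conjugation in the second factor. -/
noncomputable def conjHomeo (E : Type*) [TopologicalSpace E] : (E × ℂ) ≃ₜ (E × ℂ) :=
  (Homeomorph.refl E).prodCongr Complex.conjCLE.toHomeomorph

lemma conjHomeo_apply {E : Type*} [TopologicalSpace E] (p : E × ℂ) :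
    conjHomeo E p = (p.1, (starRingEnd ℂ) p.2) := rfl

lemma conjHomeo_symm {E : Type*} [TopologicalSpace E] : (conjHomeo E).symm = conjHomeo E := rfl

lemma exists_equivariant_lift {Ψ : (E × ℂ) ≃ₜ (E × ℂ)} (hΨ : ∀ e, Ψ (e, 0) = (e, 0)) :
    ∃ Ψ' : (E × ℂ) ≃ₜ (E × ℂ), (∀ e, Ψ' (e, 0) = (e, 0)) ∧
      (∀ e (s : ℝ), Ψ' (e, (s : ℂ)) = Ψ (e, (s : ℂ))) ∧
      ∃ Φ : (E × ℂ) ≃ₜ (E × ℂ), IsExpLift Ψ' Φ ∧ IsExpLift Ψ'.symm Φ.symm ∧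
        ∀ k p, Φ (deckShift E k p) = deckShift E k (Φ p) := by
  obtain ⟨Φ, hΦ, hΦ'⟩ := exists_homeomorph_isExpLift hΨ
  obtain ⟨n, hn⟩ := hΦ.exists_apply_deckShift Φ.continuous 1
  obtain ⟨m, hm⟩ := hΦ'.exists_apply_deckShift Φ.symm.continuous 1
  have hnm : n * m = 1 := by
    have h1 : Φ (Φ.symm (deckShift E 1 0)) = deckShift E (n * m) (Φ (Φ.symm 0)) := by
      rw [hm, deckShift_iterate_eq hn]
    simp only [Homeomorph.apply_symm_apply] at h1
    have h2 : (1 : ℂ) * (2 * Real.pi * I) = (n * m : ℤ) * (2 * Real.pi * I) := by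
      simpa [deckShift] using congrArg Prod.snd h1
    have h3 := mul_right_cancel₀ Complex.two_pi_I_ne_zero h2
    exact_mod_cast h3.symm
  rcases Int.eq_one_or_neg_one_of_mul_eq_one hnm with rfl | rfl
  · exact ⟨Ψ, hΨ, fun _ _ => rfl, Φ, hΦ, hΦ', fun k p => by
      rw [deckShift_iterate_eq hn, one_mul]⟩
  · refine ⟨(conjHomeo E).trans Ψ, fun e => by simp [conjHomeo_apply, hΨ], fun e s => by
      simp [conjHomeo_apply], (conjHomeo E).trans Φ, fun e w => ?_, fun e w => ?_, fun k p => ?_⟩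
    · simpa [conjHomeo_apply, Complex.exp_conj] using hΦ e ((starRingEnd ℂ) w)
    · have := hΦ' e w
      simp only [Homeomorph.symm_trans_apply, conjHomeo_symm, conjHomeo_apply, Complex.exp_conj]
      exact ⟨this.1, by rw [this.2]⟩
    · have h1 : conjHomeo E (deckShift E k p) = deckShift E (-k) (conjHomeo E p) := by
        refine Prod.ext rfl ?_
        simp [conjHomeo_apply, deckShift]
        exact Or.inl (map_ofNat _ 2)
      simp only [Homeomorph.trans_apply]
      rw [h1, deckShift_iterate_eq hn]
      congr 2; ring

/-- A connected family of logarithms of numbers in the upper half plane, one of which has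
imaginary part in `(0, 2π)`, stays in the strip of width `π`. -/
lemma im_mem_Ioo_of_sin_pos {Y : Type*} [TopologicalSpace Y] [PreconnectedSpace Y] {u : Y → ℝ}
    (hu : Continuous u) (hpos : ∀ y, 0 < Real.sin (u y)) {y₀ : Y}
    (h0 : u y₀ ∈ Ioo 0 (2 * Real.pi)) (y : Y) : u y ∈ Ioo 0 Real.pi := by
  have hord : (range u).OrdConnected := (isPreconnected_range hu).ordConnected
  have hnot : ∀ t, Real.sin t = 0 → t ∉ range u := by
    rintro t ht ⟨z, rfl⟩
    exact (hpos z).ne' ht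
  have h0' : u y₀ < Real.pi := by
    by_contra! h
    have h1 : 0 ≤ Real.sin (2 * Real.pi - u y₀) :=
      Real.sin_nonneg_of_nonneg_of_le_pi (by linarith [h0.2]) (by linarith)
    rw [Real.sin_two_pi_sub] at h1
    linarith [hpos y₀]
  constructor
  · by_contra! h
    exact hnot 0 Real.sin_zero (hord.out (mem_range_self y) (mem_range_self y₀) ⟨h, h0.1.le⟩)
  · by_contra! h
    exact hnot _ Real.sin_pi (hord.out (mem_range_self y₀) (mem_range_self y) ⟨h0'.le, h⟩)

lemma exists_normalized_lift {Ψ : (E × ℂ) ≃ₜ (E × ℂ)} (hΨ : ∀ e, Ψ (e, 0) = (e, 0))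
    (hpos : ∀ e (s : ℝ), 0 < s → 0 < (Ψ (e, (s : ℂ))).2.im) :
    ∃ Ψ' : (E × ℂ) ≃ₜ (E × ℂ), (∀ e, Ψ' (e, 0) = (e, 0)) ∧
      (∀ e (s : ℝ), Ψ' (e, (s : ℂ)) = Ψ (e, (s : ℂ))) ∧
      ∃ Φ : (E × ℂ) ≃ₜ (E × ℂ), IsExpLift Ψ' Φ ∧ IsExpLift Ψ'.symm Φ.symm ∧
        (∀ k p, Φ (deckShift E k p) = deckShift E k (Φ p)) ∧
        ∀ p, p.2.im = 0 → (Φ p).2.im ∈ Ioo 0 Real.pi := by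
  obtain ⟨Ψ', hΨ', hreal, Φ, hΦ, hΦ', heq⟩ := exists_equivariant_lift hΨ
  have hsin : ∀ e (t : ℝ), 0 < Real.sin (Φ (e, (t : ℂ))).2.im := by
    intro e t
    have h1 := hpos e (Real.exp t) (Real.exp_pos t)
    rw [← hreal, Complex.ofReal_exp, ← (hΦ e t).2, Complex.exp_im] at h1
    exact pos_of_mul_pos_right h1 (Real.exp_pos _).le
  obtain ⟨k, hk⟩ : ∃ k : ℤ, (Φ (0, ((0 : ℝ) : ℂ))).2.im - k * (2 * Real.pi) ∈
      Ico 0 (2 * Real.pi) := by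
    refine ⟨⌊(Φ (0, ((0 : ℝ) : ℂ))).2.im / (2 * Real.pi)⌋, ?_, ?_⟩
    · have := Int.floor_le ((Φ (0, ((0 : ℝ) : ℂ))).2.im / (2 * Real.pi))
      rw [le_div_iff₀ Real.two_pi_pos] at this
      linarith
    · have := Int.lt_floor_add_one ((Φ (0, ((0 : ℝ) : ℂ))).2.im / (2 * Real.pi))
      rw [div_lt_iff₀ Real.two_pi_pos] at this
      linarith
  have him : ∀ p : E × ℂ, (deckShift E (-k) p).2.im = p.2.im - k * (2 * Real.pi) := fun p => by
    simp [deckShift]; ring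
  have hsin' : ∀ q : E × ℝ, 0 < Real.sin (deckShift E (-k) (Φ (q.1, (q.2 : ℂ)))).2.im := fun q => by
    rw [him, Real.sin_sub_int_mul_two_pi]
    exact hsin q.1 q.2
  have hadd : ∀ a b : ℤ, ∀ q, deckShift E a (deckShift E b q) = deckShift E b (deckShift E a q) :=
    fun a b q => Prod.ext rfl (by simp [deckShift]; ring)
  refine ⟨Ψ', hΨ', hreal, Φ.trans (deckShift E (-k)), fun e w => ⟨(hΦ e w).1, ?_⟩,
    fun e w => ?_, fun j p => ?_, ?_⟩
  · change Complex.exp ((Φ (e, w)).2 + (-k : ℤ) * (2 * Real.pi * I)) = _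
    rw [Complex.exp_add, Complex.exp_int_mul_two_pi_mul_I, mul_one, (hΦ e w).2]
  · have := hΦ' e (w - (-k : ℤ) * (2 * Real.pi * I))
    rwa [Complex.exp_sub, Complex.exp_int_mul_two_pi_mul_I, div_one] at this
  · simp only [Homeomorph.trans_apply]
    rw [heq, hadd]
  · rintro ⟨e, w⟩ hw
    obtain ⟨t, rfl⟩ : ∃ t : ℝ, w = (t : ℂ) := ⟨w.re, Complex.ext rfl hw⟩
    refine im_mem_Ioo_of_sin_pos (u := fun q : E × ℝ =>
      (deckShift E (-k) (Φ (q.1, (q.2 : ℂ)))).2.im) (by fun_prop) hsin' (y₀ := (0, 0)) ?_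
      (e, t)
    rw [← him] at hk
    refine ⟨lt_of_le_of_ne hk.1 fun h => ?_, hk.2⟩
    have := hsin' (0, 0)
    simp only at this h
    rw [← h, Real.sin_zero] at this
    exact lt_irrefl _ this

lemma deckShift_snd_im {E : Type*} [TopologicalSpace E] (k : ℤ) (p : E × ℂ) :
    (deckShift E k p).2.im = p.2.im + k * (2 * Real.pi) := by
  simp [deckShift]

lemma lift_half_strip {Φ : (E × ℂ) ≃ₜ (E × ℂ)}
    (heq : ∀ k p, Φ (deckShift E k p) = deckShift E k (Φ p))
    (hstrip : ∀ p, p.2.im = 0 → (Φ p).2.im ∈ Ioo 0 Real.pi) :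
    (∀ p, 0 ≤ p.2.im → 0 < (Φ p).2.im) ∧ (∀ p, p.2.im ≤ 0 → (Φ p).2.im < Real.pi) := by
  have hpi := Real.pi_pos
  have hlin : IsLinearMap ℝ fun p : E × ℂ => p.2.im := ⟨fun _ _ => by simp, fun _ _ => by simp⟩
  have hb := hstrip (0, 0) (by simp)
  constructor
  · intro p hp
    by_contra! h
    have hconn : IsPreconnected ((fun q => (Φ.symm q).2.im) '' {q : E × ℂ | q.2.im ≤ 0}) :=
      (convex_halfSpace_le hlin 0).isPreconnected.image _ (by fun_prop)
    obtain ⟨q, hq, hq0⟩ : (0 : ℝ) ∈ (fun q => (Φ.symm q).2.im) '' {q : E × ℂ | q.2.im ≤ 0} := by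
      refine hconn.ordConnected.out (x := (deckShift E (-1) (0, 0)).2.im) ?_
        ⟨Φ p, h, rfl⟩ ⟨?_, by simpa using hp⟩
      · refine ⟨Φ (deckShift E (-1) (0, 0)), ?_, by simp⟩
        simp only [mem_ofPred_eq, heq, deckShift_snd_im]
        push_cast
        linarith [hb.2]
      · simp only [deckShift_snd_im]
        push_cast
        simp; linarith
    have := (hstrip _ hq0).1
    simp only [Homeomorph.apply_symm_apply] at this
    exact absurd this (not_lt.2 hq)
  · intro p hp
    by_contra! h
    have hconn : IsPreconnected ((fun q => (Φ.symm q).2.im) '' {q : E × ℂ | Real.pi ≤ q.2.im}) :=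
      (convex_halfSpace_ge hlin Real.pi).isPreconnected.image _ (by fun_prop)
    obtain ⟨q, hq, hq0⟩ : (0 : ℝ) ∈
        (fun q => (Φ.symm q).2.im) '' {q : E × ℂ | Real.pi ≤ q.2.im} := by
      refine hconn.ordConnected.out (y := (deckShift E 1 (0, 0)).2.im) ⟨Φ p, h, rfl⟩ ?_
        ⟨by simpa using hp, ?_⟩
      · refine ⟨Φ (deckShift E 1 (0, 0)), ?_, by simp⟩
        simp only [mem_ofPred_eq, heq, deckShift_snd_im]
        push_cast
        linarith [hb.1]
      · simp only [deckShift_snd_im]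
        push_cast
        simp; linarith
    have := (hstrip _ hq0).2
    simp only [Homeomorph.apply_symm_apply] at this
    exact absurd this (not_lt.2 hq)

lemma abs_lift_im_sub_le {E : Type*} [TopologicalSpace E] {Φ : (E × ℂ) ≃ₜ (E × ℂ)}
    (heq : ∀ k p, Φ (deckShift E k p) = deckShift E k (Φ p))
    (h1 : ∀ p, 0 ≤ p.2.im → 0 < (Φ p).2.im) (h2 : ∀ p, p.2.im ≤ 0 → (Φ p).2.im < Real.pi)
    (p : E × ℂ) : |(Φ p).2.im - p.2.im| ≤ 3 * Real.pi := by
  have hpi := Real.pi_pos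
  let k := ⌊p.2.im / (2 * Real.pi)⌋
  have hk1 := Int.floor_le (p.2.im / (2 * Real.pi))
  have hk2 := Int.lt_floor_add_one (p.2.im / (2 * Real.pi))
  rw [le_div_iff₀ Real.two_pi_pos] at hk1
  rw [div_lt_iff₀ Real.two_pi_pos] at hk2
  have a1 := h1 (deckShift E (-k) p) (by rw [deckShift_snd_im]; push_cast; linarith)
  have a2 := h2 (deckShift E (-k - 1) p) (by rw [deckShift_snd_im]; push_cast; linarith)
  rw [heq, deckShift_snd_im] at a1 a2
  push_cast at a1 a2
  rw [abs_le]
  constructor <;> linarith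

end LogarithmicLift

section BlowUp

variable {E : Type*} [NormedAddCommGroup E]

/-- Conditions on a self-map of `E × ℂ` under which it extends, in the coordinates
`x = y · Im w`, `y = g (exp (Re w))`, by the identity on `y ≤ 0`. -/
structure IsTame (g : ℝ ≃o ℝ) (f : E × ℂ → E × ℂ) : Prop where
  cont : Continuous f
  im : ∃ C : ℝ, ∀ p, |(f p).2.im - p.2.im| ≤ C
  radial : ∀ e₀ : E, ∃ δ > 0, ∃ B : ℝ, ∀ e w, ‖e - e₀‖ < δ → Real.exp w.re < δ →
    |1 / g (Real.exp (f (e, w)).2.re) - 1 / g (Real.exp w.re)| ≤ B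
  base : ∀ e₀ : E, ∀ ε > 0, ∃ δ > 0, ∀ e w, ‖e - e₀‖ < δ → Real.exp w.re < δ →
    ‖(f (e, w)).1 - e₀‖ < ε

/-- The map of `E × ℝ × ℝ` induced by `f` in the coordinates `x = y · Im w`, `y = g (exp (Re w))`,
and the identity for `y ≤ 0`. -/
noncomputable def hatMap {E : Type*} (g : ℝ ≃o ℝ) (f : E × ℂ → E × ℂ) (p : E × ℝ × ℝ) : E × ℝ × ℝ :=
  if p.2.2 ≤ 0 then p else
    ((f (p.1, ⟨Real.log (g.symm p.2.2), p.2.1 / p.2.2⟩)).1,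
      g (Real.exp (f (p.1, ⟨Real.log (g.symm p.2.2), p.2.1 / p.2.2⟩)).2.re) *
        (f (p.1, ⟨Real.log (g.symm p.2.2), p.2.1 / p.2.2⟩)).2.im,
      g (Real.exp (f (p.1, ⟨Real.log (g.symm p.2.2), p.2.1 / p.2.2⟩)).2.re))

lemma hatMap_of_nonpos {E : Type*} {g : ℝ ≃o ℝ} {f : E × ℂ → E × ℂ} {p : E × ℝ × ℝ} (hp : p.2.2 ≤ 0) :
    hatMap g f p = p := if_pos hp

lemma hatMap_of_pos {E : Type*} {g : ℝ ≃o ℝ} {f : E × ℂ → E × ℂ} {p : E × ℝ × ℝ} (hp : 0 < p.2.2) :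
    hatMap g f p = ((f (p.1, ⟨Real.log (g.symm p.2.2), p.2.1 / p.2.2⟩)).1,
      g (Real.exp (f (p.1, ⟨Real.log (g.symm p.2.2), p.2.1 / p.2.2⟩)).2.re) *
        (f (p.1, ⟨Real.log (g.symm p.2.2), p.2.1 / p.2.2⟩)).2.im,
      g (Real.exp (f (p.1, ⟨Real.log (g.symm p.2.2), p.2.1 / p.2.2⟩)).2.re)) :=
  if_neg (not_le.2 hp)

lemma orderIso_apply_pos_of_zero {g : ℝ ≃o ℝ} (hg : g 0 = 0) {r : ℝ} (hr : 0 < r) : 0 < g r := by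
  rw [← hg]; exact g.strictMono hr

lemma orderIso_symm_zero_of_zero {g : ℝ ≃o ℝ} (hg : g 0 = 0) : g.symm 0 = 0 := by
  rw [g.symm_apply_eq, hg]

lemma hatMap_comp {E : Type*} {g : ℝ ≃o ℝ} (hg : g 0 = 0) {f f' : E × ℂ → E × ℂ} (hf : ∀ p, f' (f p) = p)
    (p : E × ℝ × ℝ) : hatMap g f' (hatMap g f p) = p := by
  rcases le_or_gt p.2.2 0 with hp | hp
  · rw [hatMap_of_nonpos hp, hatMap_of_nonpos hp]
  · have hs : 0 < g.symm p.2.2 :=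
      orderIso_apply_pos_of_zero (orderIso_symm_zero_of_zero hg) hp
    rw [hatMap_of_pos hp]
    set q := f (p.1, ⟨Real.log (g.symm p.2.2), p.2.1 / p.2.2⟩) with hq
    have hy : 0 < g (Real.exp q.2.re) := orderIso_apply_pos_of_zero hg (Real.exp_pos _)
    have hq' : (q.1, (⟨Real.log (g.symm (g (Real.exp q.2.re))),
        g (Real.exp q.2.re) * q.2.im / g (Real.exp q.2.re)⟩ : ℂ)) = q := by
      rw [OrderIso.symm_apply_apply, Real.log_exp, mul_div_cancel_left₀ _ hy.ne']
    rw [hatMap_of_pos hy]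
    simp only
    rw [hq', hq, hf]
    simp only [Real.exp_log hs, OrderIso.apply_symm_apply]
    rw [mul_div_cancel₀ _ hp.ne']

lemma abs_sub_le_of_abs_one_div_sub_le {y y' B : ℝ} (hy : 0 < y) (hy' : 0 < y')
    (h : |1 / y' - 1 / y| ≤ B) (hB : B * y ≤ 1 / 2) : y' ≤ 2 * y ∧ |y' - y| ≤ 2 * B * y ^ 2 := by
  have h1 : |y' - y| ≤ B * y * y' := by
    have : y' - y = -((1 / y' - 1 / y) * (y * y')) := by field_simp; ring
    rw [this, abs_neg, abs_mul, abs_of_pos (mul_pos hy hy')]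
    nlinarith [mul_pos hy hy']
  have hB0 : 0 ≤ B := (abs_nonneg _).trans h
  have h2 : y' ≤ 2 * y := by nlinarith [le_abs_self (y' - y)]
  exact ⟨h2, by nlinarith [mul_nonneg hB0 hy.le]⟩

lemma IsTame.continuous_hatMap {g : ℝ ≃o ℝ} (hg : g 0 = 0) {f : E × ℂ → E × ℂ}
    (hf : IsTame g f) : Continuous (hatMap g f) := by
  have hgc := g.continuous
  have hgs := g.symm.continuous
  have hfc := hf.cont
  have hg' := orderIso_symm_zero_of_zero hg
  rw [continuous_iff_continuousAt]
  rintro ⟨e₀, x₀, y₀⟩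
  rcases lt_trichotomy y₀ 0 with hy | rfl | hy
  · have : hatMap g f =ᶠ[𝓝 (e₀, x₀, y₀)] id := by
      have hopen : IsOpen {p : E × ℝ × ℝ | p.2.2 < 0} := isOpen_lt (by fun_prop) continuous_const
      filter_upwards [hopen.mem_nhds hy] with p hp
      exact hatMap_of_nonpos (le_of_lt hp)
    exact continuousAt_id.congr this.symm
  · obtain ⟨C, hC⟩ := hf.im
    obtain ⟨δ, hδ, B₀, hB₀⟩ := hf.radial e₀
    have hp0 : hatMap g f (e₀, x₀, 0) = (e₀, x₀, 0) := hatMap_of_nonpos le_rfl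
    let B := |B₀|
    have hB : ∀ e w, ‖e - e₀‖ < δ → Real.exp w.re < δ →
        |1 / g (Real.exp (f (e, w)).2.re) - 1 / g (Real.exp w.re)| ≤ B :=
      fun e w he hw => (hB₀ e w he hw).trans (le_abs_self _)
    have hB1 : 0 ≤ B := abs_nonneg _
    have hC0 : 0 ≤ C := (abs_nonneg _).trans (hC 0)
    have near : ∀ δ > 0, ∀ᶠ p : E × ℝ × ℝ in 𝓝 (e₀, x₀, 0),
        ‖p.1 - e₀‖ < δ ∧ g.symm p.2.2 < δ := by
      intro δ hδ
      have c1 : Continuous fun p : E × ℝ × ℝ => ‖p.1 - e₀‖ := by fun_prop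
      have c2 : Continuous fun p : E × ℝ × ℝ => g.symm p.2.2 := by fun_prop
      exact ((isOpen_lt c1 continuous_const).inter (isOpen_lt c2 continuous_const)).mem_nhds
        (show ‖e₀ - e₀‖ < δ ∧ g.symm 0 < δ by simp [hg', hδ])
    have hsmall : ∀ᶠ p : E × ℝ × ℝ in 𝓝 (e₀, x₀, 0), B * p.2.2 < 1 / 2 := by
      have c : Continuous fun p : E × ℝ × ℝ => B * p.2.2 := by fun_prop
      exact (isOpen_lt c continuous_const).mem_nhds
        (show B * 0 < 1 / 2 by norm_num)
    have hy : ∀ᶠ p : E × ℝ × ℝ in 𝓝 (e₀, x₀, 0),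
        |(hatMap g f p).2.2 - p.2.2| ≤ 2 * B * p.2.2 ^ 2 ∧
        |(hatMap g f p).2.1 - p.2.1| ≤ |p.2.2| * (2 * C + 2 * B * |p.2.1|) := by
      filter_upwards [near δ hδ, hsmall] with p hp hps
      rcases le_or_gt p.2.2 0 with h | h
      · rw [hatMap_of_nonpos h, sub_self, sub_self, abs_zero]
        exact ⟨by positivity, by positivity⟩
      · rw [hatMap_of_pos h]
        have hs : 0 < g.symm p.2.2 := orderIso_apply_pos_of_zero hg' h
        set w : ℂ := ⟨Real.log (g.symm p.2.2), p.2.1 / p.2.2⟩ with hw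
        have hwre : Real.exp w.re = g.symm p.2.2 := Real.exp_log hs
        have h1 := hB p.1 w hp.1 (hwre ▸ hp.2)
        rw [hwre, OrderIso.apply_symm_apply] at h1
        have hy' : 0 < g (Real.exp (f (p.1, w)).2.re) :=
          orderIso_apply_pos_of_zero hg (Real.exp_pos _)
        obtain ⟨h2, h3⟩ := abs_sub_le_of_abs_one_div_sub_le h hy' h1 hps.le
        refine ⟨h3, ?_⟩
        have h4 := hC (p.1, w)
        simp only
        set y' := g (Real.exp (f (p.1, w)).2.re)
        set η := (f (p.1, w)).2.im
        have h5 : y' * η - p.2.1 = y' * (η - w.im) + (y' - p.2.2) * (p.2.1 / p.2.2) := by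
          simp only [hw]; field_simp; ring
        rw [h5, abs_of_pos h]
        refine (abs_add_le _ _).trans ?_
        rw [abs_mul, abs_mul, abs_of_pos hy', abs_div, abs_of_pos h]
        have h6 : |y' - p.2.2| * (|p.2.1| / p.2.2) ≤ 2 * B * p.2.2 ^ 2 * (|p.2.1| / p.2.2) :=
          mul_le_mul_of_nonneg_right h3 (by positivity)
        have h7 : 2 * B * p.2.2 ^ 2 * (|p.2.1| / p.2.2) = p.2.2 * (2 * B * |p.2.1|) := by
          field_simp
        have h8 : y' * |η - w.im| ≤ 2 * p.2.2 * C :=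
          mul_le_mul h2 h4 (abs_nonneg _) (by positivity)
        linarith
    refine ContinuousAt.prodMk ?_ (ContinuousAt.prodMk ?_ ?_)
      (f := fun p => (hatMap g f p).1) (g := fun p => (hatMap g f p).2)
    · rw [ContinuousAt, hp0, Metric.tendsto_nhds]
      intro ε hε
      obtain ⟨δ', hδ', h'⟩ := hf.base e₀ ε hε
      filter_upwards [near δ' hδ', near ε hε] with p hp hpε
      rw [dist_eq_norm]
      rcases le_or_gt p.2.2 0 with h | h
      · rw [hatMap_of_nonpos h]
        exact hpε.1
      · rw [hatMap_of_pos h]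
        refine h' _ _ hp.1 ?_
        rw [Real.exp_log (orderIso_apply_pos_of_zero hg' h)]
        exact hp.2
    · have h0 : Tendsto (fun p : E × ℝ × ℝ => (hatMap g f p).2.1 - p.2.1) (𝓝 (e₀, x₀, 0)) (𝓝 0) := by
        refine squeeze_zero_norm' (hy.mono fun p hp => hp.2) ?_
        have : ContinuousAt (fun p : E × ℝ × ℝ => |p.2.2| * (2 * C + 2 * B * |p.2.1|))
          (e₀, x₀, 0) := by fun_prop
        simpa [ContinuousAt] using this
      have h1 : Tendsto (fun p : E × ℝ × ℝ => p.2.1) (𝓝 (e₀, x₀, 0)) (𝓝 x₀) :=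
        (by fun_prop : ContinuousAt (fun p : E × ℝ × ℝ => p.2.1) (e₀, x₀, 0))
      simpa [ContinuousAt, hp0] using h0.add h1
    · have h0 : Tendsto (fun p : E × ℝ × ℝ => (hatMap g f p).2.2 - p.2.2) (𝓝 (e₀, x₀, 0)) (𝓝 0) := by
        refine squeeze_zero_norm' (hy.mono fun p hp => hp.1) ?_
        have : ContinuousAt (fun p : E × ℝ × ℝ => 2 * B * p.2.2 ^ 2) (e₀, x₀, 0) := by fun_prop
        simpa [ContinuousAt] using this
      have h1 : Tendsto (fun p : E × ℝ × ℝ => p.2.2) (𝓝 (e₀, x₀, 0)) (𝓝 0) :=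
        (by fun_prop : ContinuousAt (fun p : E × ℝ × ℝ => p.2.2) (e₀, x₀, 0))
      simpa [ContinuousAt, hp0] using h0.add h1
  · have hopen : IsOpen {p : E × ℝ × ℝ | 0 < p.2.2} := isOpen_lt continuous_const (by fun_prop)
    refine ContinuousAt.congr ?_ (Filter.mem_of_superset (hopen.mem_nhds (show (0 : ℝ) < y₀ from hy))
      fun p hp => (hatMap_of_pos hp).symm)
    have hs : g.symm y₀ ≠ 0 := (orderIso_apply_pos_of_zero hg' hy).ne'
    have hw : ContinuousAt (fun p : E × ℝ × ℝ =>
        (⟨Real.log (g.symm p.2.2), p.2.1 / p.2.2⟩ : ℂ)) (e₀, x₀, y₀) := by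
      refine (Complex.equivRealProdCLM.symm.continuous.continuousAt).comp
        (f := fun p : E × ℝ × ℝ => (Real.log (g.symm p.2.2), p.2.1 / p.2.2)) ?_
      refine ContinuousAt.prodMk (ContinuousAt.log (by fun_prop) hs)
        (ContinuousAt.div (by fun_prop) (by fun_prop) hy.ne')
    have hF : ContinuousAt (fun p : E × ℝ × ℝ =>
        f (p.1, ⟨Real.log (g.symm p.2.2), p.2.1 / p.2.2⟩)) (e₀, x₀, y₀) :=
      hfc.continuousAt.comp (f := fun p : E × ℝ × ℝ =>
        (p.1, (⟨Real.log (g.symm p.2.2), p.2.1 / p.2.2⟩ : ℂ))) (continuousAt_fst.prodMk hw)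
    have hout : Continuous fun q : E × ℂ =>
        (q.1, g (Real.exp q.2.re) * q.2.im, g (Real.exp q.2.re)) := by fun_prop
    exact hout.continuousAt.comp hF

/-- The homeomorphism induced by a tame homeomorphism. -/
noncomputable def hatHomeo {g : ℝ ≃o ℝ} (hg : g 0 = 0) (Φ : (E × ℂ) ≃ₜ (E × ℂ))
    (h : IsTame g Φ) (h' : IsTame g Φ.symm) : (E × ℝ × ℝ) ≃ₜ (E × ℝ × ℝ) where
  toFun := hatMap g Φ
  invFun := hatMap g Φ.symm
  left_inv := hatMap_comp hg Φ.symm_apply_apply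
  right_inv := hatMap_comp hg Φ.apply_symm_apply
  continuous_toFun := h.continuous_hatMap hg
  continuous_invFun := h'.continuous_hatMap hg

end BlowUp

lemma IsExpLift.isTame {E : Type*} [NormedAddCommGroup E] {g : ℝ ≃o ℝ} {Ψ Φ : E × ℂ → E × ℂ}
    (hΨ : ∀ e, Ψ (e, 0) = (e, 0)) (hΨc : Continuous Ψ) (hΦ : Continuous Φ) (h : IsExpLift Ψ Φ)
    (hg : RadiallyTame g Ψ) {C : ℝ} (hC : ∀ p, |(Φ p).2.im - p.2.im| ≤ C) : IsTame g Φ where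
  cont := hΦ
  im := ⟨C, hC⟩
  radial e₀ := by
    obtain ⟨δ, hδ, B, hB⟩ := hg e₀
    refine ⟨δ, hδ, B, fun e w he hw => ?_⟩
    have := hB e (Complex.exp w) he (norm_pos_iff.2 (Complex.exp_ne_zero w))
      (by rwa [Complex.norm_exp])
    rwa [← (h e w).2, Complex.norm_exp, Complex.norm_exp] at this
  base e₀ ε hε := by
    obtain ⟨δ, hδ, hd⟩ := Metric.continuousAt_iff.1 (hΨc.fst.continuousAt (x := (e₀, (0 : ℂ)))) ε hε
    refine ⟨δ, hδ, fun e w he hw => ?_⟩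
    have := @hd (e, Complex.exp w) (by
      rw [Prod.dist_eq, max_lt_iff, dist_eq_norm, dist_zero_right, Complex.norm_exp]
      exact ⟨he, hw⟩)
    rwa [hΨ, dist_eq_norm, ← (h e w).1] at this

section Carry

/-- A continuous family of increasing bijections of the line is a homeomorphism. -/
lemma exists_homeomorph_of_strictMono_fibres {A : Type*} [TopologicalSpace A] {f : A × ℝ → ℝ}
    (hf : Continuous f) (hm : ∀ a, StrictMono fun t => f (a, t))
    (hs : ∀ a, Function.Surjective fun t => f (a, t)) :
    ∃ h : (A × ℝ) ≃ₜ (A × ℝ), ∀ a t, h (a, t) = (a, f (a, t)) := by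
  choose k hk using hs
  simp only at hk
  have hk' : ∀ a t, k a (f (a, t)) = t := fun a t => (hm a).injective (hk a (f (a, t)))
  have hkc : Continuous fun p : A × ℝ => k p.1 p.2 := by
    rw [continuous_iff_continuousAt]
    rintro ⟨a₀, u₀⟩
    refine tendsto_order.2 ⟨fun b hb => ?_, fun b hb => ?_⟩
    · have h0 : f (a₀, b) < u₀ := by rw [← hk a₀ u₀]; exact hm a₀ hb
      have hc : Continuous fun p : A × ℝ => f (p.1, b) := by fun_prop
      filter_upwards [(isOpen_lt hc continuous_snd).mem_nhds h0] with p hp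
      refine (hm p.1).lt_iff_lt.1 ?_
      simp only [hk]
      exact hp
    · have h0 : u₀ < f (a₀, b) := by rw [← hk a₀ u₀]; exact hm a₀ hb
      have hc : Continuous fun p : A × ℝ => f (p.1, b) := by fun_prop
      filter_upwards [(isOpen_lt continuous_snd hc).mem_nhds h0] with p hp
      refine (hm p.1).lt_iff_lt.1 ?_
      simp only [hk]
      exact hp
  exact ⟨{ toFun := fun p => (p.1, f p)
           invFun := fun p => (p.1, k p.1 p.2)
           left_inv := fun p => Prod.ext rfl (hk' p.1 p.2)
           right_inv := fun p => Prod.ext rfl (hk p.1 p.2)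
           continuous_toFun := by fun_prop
           continuous_invFun := by fun_prop }, fun a t => rfl⟩

/-- The transition function along the lines `x + y = s` of the homeomorphism turning the
half-line `y = 0 ≤ x` to the half-line `x = 0 ≤ y`. -/
noncomputable def turn (s k y : ℝ) : ℝ := max y (min (2 * y + max s 0) (max s 0 + k * y))

lemma turn_strictMono {s k : ℝ} (h1 : k ≤ 1 / 2) (hk : 0 < s → 0 < k) :
    StrictMono (turn s k) := by
  intro a b hab
  have h2 : ∀ y, s ≤ 0 → turn s k y = y := by
    intro y hs
    rw [turn, max_eq_right hs]
    refine max_eq_left ?_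
    rcases le_total 0 y with hy | hy
    · exact (min_le_right _ _).trans (by nlinarith)
    · exact (min_le_left _ _).trans (by linarith)
  rcases le_or_gt s 0 with hs | hs
  · rwa [h2 a hs, h2 b hs]
  · exact max_lt_max hab (min_lt_min (by linarith) (by nlinarith [hk hs]))

lemma turn_surjective {s k : ℝ} : Function.Surjective (turn s k) := by
  intro v
  have hc : Continuous (turn s k) := by unfold turn; fun_prop
  have h1 : turn s k (min v ((v - max s 0) / 2)) ≤ v := by
    refine max_le (min_le_left _ _) ((min_le_left _ _).trans ?_)
    have := min_le_right v ((v - max s 0) / 2)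
    linarith
  obtain ⟨y, -, hy⟩ := intermediate_value_Icc (min_le_left v ((v - max s 0) / 2)) hc.continuousOn
    ⟨h1, le_max_left _ _⟩
  exact ⟨y, hy⟩

variable {E : Type*} [PseudoMetricSpace E]

lemma exists_turn {O : Set (E × ℝ × ℝ)} (hO : IsOpen O) (hne : ∀ e, (e, -1, -1) ∉ O)
    (h1 : ∀ e x y, y ≤ 0 → 0 < x → (e, x, y) ∈ O) (h2 : ∀ e x y, 0 ≤ x → 0 < y → (e, x, y) ∈ O) :
    ∃ h : (E × ℝ × ℝ) ≃ₜ (E × ℝ × ℝ), (∀ p ∉ O, h p = p) ∧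
      ∀ e x, 0 ≤ x → h (e, x, 0) = (e, 0, x) := by
  let D : E × ℝ → ℝ := fun a => Metric.infDist (a.1, 0, a.2) Oᶜ
  let k : E × ℝ → ℝ := fun a => min (1 / 2) (D a / (2 * (1 + |a.2|)))
  have hDc : Continuous D := (Metric.continuous_infDist_pt _).comp (by fun_prop)
  have hpos : ∀ a : E × ℝ, 0 < 2 * (1 + |a.2|) := fun a => by positivity
  have hkc : Continuous k :=
    continuous_const.min (hDc.div (by fun_prop) fun a => (hpos a).ne')
  have hD0 : ∀ a, 0 ≤ D a := fun a => Metric.infDist_nonneg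
  have hk0 : ∀ a, 0 ≤ k a := fun a => le_min (by norm_num) (div_nonneg (hD0 a) (hpos a).le)
  have hkpos : ∀ a : E × ℝ, 0 < a.2 → 0 < k a := by
    intro a ha
    refine lt_min (by norm_num) (div_pos ?_ (hpos a))
    refine (hO.isClosed_compl.notMem_iff_infDist_pos ⟨(a.1, -1, -1), hne a.1⟩).1 ?_
    exact not_not.2 (h2 _ _ _ le_rfl ha)
  obtain ⟨h, hh⟩ := exists_homeomorph_of_strictMono_fibres
    (f := fun p : (E × ℝ) × ℝ => turn p.1.2 (k p.1) p.2) (by unfold turn; fun_prop)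
    (fun a => turn_strictMono (min_le_left _ _) (hkpos a)) fun a => turn_surjective (s := a.2) (k := k a)
  let L : (E × ℝ × ℝ) ≃ₜ ((E × ℝ) × ℝ) :=
    { toFun := fun p => ((p.1, p.2.1 + p.2.2), p.2.2)
      invFun := fun p => (p.1.1, p.1.2 - p.2, p.2)
      left_inv := fun p => by simp
      right_inv := fun p => by simp
      continuous_toFun := by fun_prop
      continuous_invFun := by fun_prop }
  have hval : ∀ e x y, (L.trans (h.trans L.symm)) (e, x, y) =
      (e, x + y - turn (x + y) (k (e, x + y)) y, turn (x + y) (k (e, x + y)) y) := by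
    intro e x y
    change L.symm (h ((e, x + y), y)) = _
    rw [hh]
    rfl
  refine ⟨L.trans (h.trans L.symm), ?_, fun e x hx => ?_⟩
  · rintro ⟨e, x, y⟩ hp
    suffices turn (x + y) (k (e, x + y)) y = y by rw [hval, this]; simp
    refine max_eq_left (not_lt.1 fun hlt => hp ?_)
    obtain ⟨hl1, hl2⟩ := lt_min_iff.1 hlt
    have hk1 : k (e, x + y) ≤ 1 / 2 := min_le_left _ _
    have hk2 := hk0 (e, x + y)
    have hs : 0 < x + y := by
      by_contra! hs
      rw [max_eq_right hs] at hl1 hl2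
      nlinarith
    rw [max_eq_left hs.le] at hl1 hl2
    rcases le_or_gt y 0 with hy | hy
    · exact h1 _ _ _ hy (by linarith)
    rcases le_or_gt 0 x with hx | hx
    · exact h2 _ _ _ hx hy
    by_contra hp
    have hdist : D (e, x + y) ≤ -x := by
      refine (Metric.infDist_le_dist_of_mem (show (e, x, y) ∈ Oᶜ from hp)).trans ?_
      simp only [Prod.dist_eq, dist_self, Real.dist_eq]
      have e1 : |0 - x| = -x := by rw [zero_sub, abs_neg, abs_of_neg hx]
      have e2 : |x + y - y| = -x := by rw [add_sub_cancel_right, abs_of_neg hx]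
      rw [e1, e2, max_self, max_eq_right (by linarith)]
    have hk3 : k (e, x + y) * (2 * (1 + (x + y))) ≤ -x := by
      have : k (e, x + y) ≤ D (e, x + y) / (2 * (1 + |x + y|)) := min_le_right _ _
      rw [abs_of_pos hs, le_div_iff₀ (by positivity)] at this
      exact this.trans hdist
    nlinarith
  · rw [hval]
    simp [turn, hx]

lemma exists_carry {Φ : (E × ℝ × ℝ) ≃ₜ (E × ℝ × ℝ)} (h1 : ∀ p, p.2.2 ≤ 0 → Φ p = p)
    (h2 : ∀ p, 0 ≤ p.2.1 → 0 < p.2.2 → 0 < (Φ p).2.1) {c : ℝ} (hc : 0 < c) :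
    ∃ W : (E × ℝ × ℝ) ≃ₜ (E × ℝ × ℝ), (∀ p, p.2.1 ≤ 0 → W p = p) ∧
      ∀ e y, 0 ≤ y → W (e, c * y, y) = Φ (e, 0, y) := by
  obtain ⟨h, hh, hx⟩ := exists_turn (O := {p | 0 < (Φ p).2.1})
    (isOpen_lt continuous_const (by fun_prop)) (fun e => by
      rw [mem_ofPred_eq, h1 _ (by norm_num)]; norm_num)
    (fun e x y hy hx => by rw [mem_ofPred_eq, h1 _ hy]; exact hx)
    (fun e x y hx hy => h2 _ hx hy)
  let σ : (E × ℝ × ℝ) ≃ₜ (E × ℝ × ℝ) :=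
    { toFun := fun p => (p.1, p.2.1 - (1 - 1 / c) * max p.2.1 0, p.2.2 - max p.2.1 0 / c)
      invFun := fun p => (p.1, p.2.1 + (c - 1) * max p.2.1 0, p.2.2 + max p.2.1 0)
      left_inv := by
        rintro ⟨e, x, y⟩
        rcases le_total x 0 with hx | hx
        · simp [hx]
        · have : x - (1 - 1 / c) * x = x / c := by field_simp; ring
          have h' : 0 ≤ x / c := by positivity
          simp only [max_eq_left hx, this, max_eq_left h']
          refine Prod.ext rfl (Prod.ext ?_ ?_)
          · simp only; field_simp; ring
          · simp only; ring
      right_inv := by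
        rintro ⟨e, x, y⟩
        rcases le_total x 0 with hx | hx
        · simp [hx]
        · have : x + (c - 1) * x = c * x := by ring
          have h' : 0 ≤ c * x := by positivity
          simp only [max_eq_left hx, this, max_eq_left h']
          refine Prod.ext rfl (Prod.ext ?_ ?_)
          · simp only; field_simp; ring
          · simp only; field_simp; ring
      continuous_toFun := by fun_prop
      continuous_invFun := by fun_prop }
  refine ⟨σ.trans (Φ.symm.trans (h.trans Φ)), fun p hp => ?_, fun e y hy => ?_⟩
  · have hσ : σ p = p := by
      change (p.1, _, _) = p
      rw [max_eq_right hp]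
      simp
    simp only [Homeomorph.trans_apply, hσ]
    rw [hh, Homeomorph.apply_symm_apply]
    rw [mem_ofPred_eq, Homeomorph.apply_symm_apply]
    exact not_lt.2 hp
  · have hσ : σ (e, c * y, y) = (e, y, 0) := by
      change (e, c * y - _ * max (c * y) 0, y - max (c * y) 0 / c) = _
      rw [max_eq_left (by positivity)]
      refine Prod.ext rfl (Prod.ext ?_ ?_)
      · simp only; field_simp; ring
      · simp only; field_simp; ring
    have hΦ : Φ.symm (e, y, 0) = (e, y, 0) := by
      rw [Φ.symm_apply_eq, h1 _ le_rfl]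
    simp only [Homeomorph.trans_apply, hσ, hΦ, hx e y hy]

lemma exists_paste {X Y : Type*} [TopologicalSpace X] [TopologicalSpace Y] (f g : X ≃ₜ Y)
    {u : X → ℝ} {v : Y → ℝ} (hu : Continuous u) (hv : Continuous v)
    (hf : ∀ x, u x ≤ 0 ↔ v (f x) ≤ 0) (hg : ∀ x, 0 < u x ↔ 0 < v (g x))
    (h0 : ∀ x, u x = 0 → f x = g x) (h0' : ∀ y, v y = 0 → f.symm y = g.symm y) :
    ∃ h : X ≃ₜ Y, (∀ x, u x ≤ 0 → h x = f x) ∧ ∀ x, 0 ≤ u x → h x = g x := by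
  have hf' : ∀ y, u (f.symm y) ≤ 0 ↔ v y ≤ 0 := fun y => by rw [hf, f.apply_symm_apply]
  have hg' : ∀ y, 0 < u (g.symm y) ↔ 0 < v y := fun y => by rw [hg, g.apply_symm_apply]
  refine ⟨{ toFun := fun x => if u x ≤ 0 then f x else g x
            invFun := fun y => if v y ≤ 0 then f.symm y else g.symm y
            left_inv := fun x => ?_
            right_inv := fun y => ?_
            continuous_toFun := f.continuous.if_le g.continuous hu continuous_const h0
            continuous_invFun := f.symm.continuous.if_le g.symm.continuous hv continuous_const h0' },
    fun x hx => if_pos hx, fun x hx => ?_⟩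
  · simp only
    split_ifs with hx hx' hx'
    · simp
    · exact absurd ((hf x).1 hx) hx'
    · exact absurd ((hg x).1 (not_le.1 hx)) (not_lt.2 hx')
    · simp
  · simp only
    split_ifs with hx hx' hx'
    · simp
    · exact absurd ((hf' y).2 hx) hx'
    · exact absurd ((hg' y).2 (not_le.1 hx)) (not_lt.2 hx')
    · simp
  · change (if u x ≤ 0 then f x else g x) = g x
    split_ifs with h
    · exact h0 x (le_antisymm h hx)
    · rfl

lemma lt_zero_of_isPreconnected {X : Type*} [TopologicalSpace X] {S : Set X}
    (hS : IsPreconnected S) {w : X → ℝ} (hw : ContinuousOn w S) (h0 : ∀ x ∈ S, w x ≠ 0) {x₀ : X}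
    (hx₀ : x₀ ∈ S) (hneg : w x₀ < 0) : ∀ x ∈ S, w x < 0 := by
  intro x hx
  by_contra! hpos
  obtain ⟨z, hz, hz0⟩ := hS.intermediate_value hx₀ hx hw ⟨hneg.le, hpos⟩
  exact h0 z hz hz0

/-- A homeomorphism matching two zero sets matches the sides. -/
lemma sides_of_homeomorph {X : Type*} [TopologicalSpace X] {q : X ≃ₜ X} {u v : X → ℝ}
    (hv : Continuous v) (h0 : ∀ x, u x = 0 ↔ v (q x) = 0)
    (hneg : IsPreconnected {x | u x < 0}) (hpos : IsPreconnected {x | 0 < u x})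
    {x₀ x₁ : X} (hx₀ : u x₀ < 0) (hvx₀ : v (q x₀) < 0) (hx₁ : 0 < v x₁) (x : X) :
    (u x < 0 ↔ v (q x) < 0) ∧ (0 < u x ↔ 0 < v (q x)) := by
  have hc : Continuous fun x => v (q x) := by fun_prop
  have h1 : ∀ x, u x < 0 → v (q x) < 0 :=
    lt_zero_of_isPreconnected hneg hc.continuousOn
      (fun x hx => mt (h0 x).2 (ne_of_lt hx)) hx₀ hvx₀
  have hx₁' : 0 < v (q (q.symm x₁)) := by rwa [q.apply_symm_apply]
  have hu₁ : 0 < u (q.symm x₁) := by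
    rcases lt_trichotomy (u (q.symm x₁)) 0 with h | h | h
    · exact absurd (h1 _ h) hx₁'.not_gt
    · exact absurd ((h0 _).1 h) hx₁'.ne'
    · exact h
  have h2 : ∀ x, 0 < u x → 0 < v (q x) := by
    have := lt_zero_of_isPreconnected hpos (w := fun x => -v (q x)) hc.neg.continuousOn
      (fun x hx => neg_ne_zero.2 (mt (h0 x).2 (ne_of_gt hx))) hu₁ (neg_neg_iff_pos.2 hx₁')
    exact fun x hx => neg_neg_iff_pos.1 (this x hx)
  have h0x := h0 x
  rcases lt_trichotomy (u x) 0 with h | h | h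
  · have := h1 x h
    constructor <;> constructor <;> intro <;> linarith
  · have := h0x.1 h
    constructor <;> constructor <;> intro <;> linarith
  · have := h2 x h
    constructor <;> constructor <;> intro <;> linarith

end Carry

section Sector

variable {E : Type*} [NormedAddCommGroup E] [NormedSpace ℝ E]

lemma sides_of_carry {Φ W : (E × ℝ × ℝ) ≃ₜ (E × ℝ × ℝ)} (h1 : ∀ p, p.2.2 ≤ 0 → Φ p = p) {c : ℝ}
    (hc : 0 < c) (hW : ∀ e y, 0 ≤ y → W (e, c * y, y) = Φ (e, 0, y))
    (hW' : ∀ e y, y ≤ 0 → W (e, c * y, y) = (e, c * y, y))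
    (ht : W (0, -c - 1, -1) = (0, -c - 1, -1) ∨ W (0, 1, -1) = (0, 1, -1)) (x : E × ℝ × ℝ) :
    (x.2.1 - c * x.2.2 < 0 ↔ (Φ.symm (W x)).2.1 - c * min (Φ.symm (W x)).2.2 0 < 0) ∧
    (0 < x.2.1 - c * x.2.2 ↔ 0 < (Φ.symm (W x)).2.1 - c * min (Φ.symm (W x)).2.2 0) := by
  have h1' : ∀ p, p.2.2 ≤ 0 → Φ.symm p = p := fun p hp => by rw [Φ.symm_apply_eq, h1 p hp]
  let q := W.trans Φ.symm
  let u : E × ℝ × ℝ → ℝ := fun p => p.2.1 - c * p.2.2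
  let v : E × ℝ × ℝ → ℝ := fun p => p.2.1 - c * min p.2.2 0
  have hq1 : ∀ e y, 0 ≤ y → q (e, c * y, y) = (e, 0, y) := fun e y hy => by
    simp [q, hW e y hy]
  have hq2 : ∀ e y, y ≤ 0 → q (e, c * y, y) = (e, c * y, y) := fun e y hy => by
    simp [q, hW' e y hy, h1' (e, c * y, y) hy]
  have hu : Continuous u := by fun_prop
  have hv : Continuous v := by fun_prop
  have h0 : ∀ p, u p = 0 ↔ v (q p) = 0 := by
    intro p
    constructor
    · obtain ⟨e, x, y⟩ := p
      intro hp
      obtain rfl : x = c * y := sub_eq_zero.1 hp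
      rcases le_total 0 y with hy | hy
      · rw [hq1 e y hy]
        simp [v, hy]
      · rw [hq2 e y hy]
        simp [v, hy]
    · intro hp
      obtain ⟨e, x, y, hqp⟩ : ∃ e x y, q p = (e, x, y) := ⟨_, _, _, rfl⟩
      rw [hqp] at hp
      have hx : x = c * min y 0 := sub_eq_zero.1 hp
      have : p = (e, c * y, y) := by
        apply q.injective
        rw [hqp, hx]
        rcases le_total 0 y with hy | hy
        · rw [hq1 e y hy]
          simp [hy]
        · rw [hq2 e y hy]
          simp [hy]
      rw [this]
      simp [u]
  have hlin : IsLinearMap ℝ u := by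
    constructor
    · intro a b
      simp only [u, Prod.fst_add, Prod.snd_add]
      ring
    · intro a b
      simp only [u, Prod.smul_fst, Prod.smul_snd, smul_eq_mul]
      ring
  have hn : IsPreconnected {p | u p < 0} := (convex_halfSpace_lt hlin 0).isPreconnected
  have hp : IsPreconnected {p | 0 < u p} := (convex_halfSpace_gt hlin 0).isPreconnected
  rcases ht with ht | ht
  · refine sides_of_homeomorph (q := q) hv h0 hn hp (x₀ := (0, -c - 1, -1)) (x₁ := (0, 1, -1))
      ?_ ?_ ?_ x
    · simp only [u]; linarith
    · have : q (0, -c - 1, -1) = (0, -c - 1, -1) := by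
        simp only [q, Homeomorph.trans_apply, ht]
        exact h1' _ (by norm_num)
      rw [this]
      simp only [v]
      norm_num
      linarith
    · simp [v]; linarith
  · have := sides_of_homeomorph (q := q) (u := fun p => - u p) (v := fun p => - v p) hv.neg
      (fun p => by simpa using h0 p) (by simpa using hp) (by simpa using hn) (x₀ := (0, 1, -1))
      (x₁ := (0, -c - 1, -1)) (by simp only [u]; linarith) ?_ (by simp [v]) x
    · exact ⟨by simpa [u, v, q] using this.2, by simpa [u, v, q] using this.1⟩
    · have : q (0, 1, -1) = (0, 1, -1) := by
        simp only [q, Homeomorph.trans_apply, ht]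
        exact h1' _ (by norm_num)
      rw [this]
      simp [v]; linarith

lemma exists_sector_homeomorph {Φ : (E × ℝ × ℝ) ≃ₜ (E × ℝ × ℝ)} (h1 : ∀ p, p.2.2 ≤ 0 → Φ p = p)
    (h2 : ∀ p, 0 ≤ p.2.1 → 0 < p.2.2 → 0 < (Φ p).2.1)
    (h3 : ∀ p, p.2.1 ≤ 0 → 0 < p.2.2 → (Φ p).2.1 < Real.pi * (Φ p).2.2) :
    ∃ h : (E × ℝ × ℝ) ≃ₜ (E × ℝ × ℝ),
      (∀ p, ¬ (0 < p.2.1 ∧ p.2.1 < Real.pi * p.2.2) → h p = p) ∧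
      ∀ e y, 0 ≤ y → h (e, Real.pi / 2 * y, y) = Φ (e, 0, y) := by
  have hpi := Real.pi_pos
  set c := Real.pi / 2 with hcdef
  have hpc : Real.pi = 2 * c := by rw [hcdef]; ring
  have hc : 0 < c := by positivity
  have hΦpos : ∀ p, 0 < p.2.2 → 0 < (Φ p).2.2 := by
    intro p hp
    by_contra! h
    have := Φ.injective (h1 _ h)
    rw [this] at h
    exact absurd hp (not_lt.2 h)
  let ν : (E × ℝ × ℝ) ≃ₜ (E × ℝ × ℝ) :=
    (Homeomorph.refl E).prodCongr ((Homeomorph.neg ℝ).prodCongr (Homeomorph.refl ℝ))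
  let μ : (E × ℝ × ℝ) ≃ₜ (E × ℝ × ℝ) :=
    { toFun := fun p => (p.1, Real.pi * p.2.2 - p.2.1, p.2.2)
      invFun := fun p => (p.1, Real.pi * p.2.2 - p.2.1, p.2.2)
      left_inv := fun p => by simp
      right_inv := fun p => by simp
      continuous_toFun := by fun_prop
      continuous_invFun := by fun_prop }
  let μ' : (E × ℝ × ℝ) ≃ₜ (E × ℝ × ℝ) :=
    { toFun := fun p => (p.1, Real.pi * max p.2.2 0 - p.2.1, p.2.2)
      invFun := fun p => (p.1, Real.pi * max p.2.2 0 - p.2.1, p.2.2)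
      left_inv := fun p => by simp
      right_inv := fun p => by simp
      continuous_toFun := by fun_prop
      continuous_invFun := by fun_prop }
  have hν : ∀ e x y, ν (e, x, y) = (e, -x, y) := fun e x y => rfl
  have hμ : ∀ e x y, μ (e, x, y) = (e, Real.pi * y - x, y) := fun e x y => rfl
  have hμ' : ∀ e x y, μ' (e, x, y) = (e, Real.pi * max y 0 - x, y) := fun e x y => rfl
  have hΦ' : ∀ p, (ν.trans (Φ.trans μ')) p = μ' (Φ (ν p)) := fun p => rfl
  obtain ⟨W₁, hW₁, hW₁'⟩ := exists_carry h1 h2 hc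
  obtain ⟨V, hV, hV'⟩ := exists_carry (Φ := ν.trans (Φ.trans μ')) (c := c)
    (by
      rintro ⟨e, x, y⟩ hy
      simp only at hy
      rw [hΦ', hν, h1 _ hy, hμ', max_eq_right hy]
      simp)
    (by
      rintro ⟨e, x, y⟩ hx hy
      simp only at hx hy
      rw [hΦ', hν]
      have a := h3 (e, -x, y) (by simpa using hx) hy
      have b := hΦpos (e, -x, y) hy
      generalize Φ (e, -x, y) = z at a b ⊢
      obtain ⟨e', x', y'⟩ := z
      rw [hμ']
      simp only at a b ⊢
      rw [max_eq_left b.le]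
      linarith) hc
  let W₂ := μ.trans (V.trans μ)
  have hW₂d : ∀ p, W₂ p = μ (V (μ p)) := fun p => rfl
  have hW₂ : ∀ p, Real.pi * p.2.2 ≤ p.2.1 → W₂ p = p := by
    rintro ⟨e, x, y⟩ hp
    simp only at hp
    rw [hW₂d, hμ e x y, hV _ (by simpa using hp), hμ]
    simp
  have hW₂' : ∀ e y, 0 ≤ y → W₂ (e, c * y, y) = Φ (e, 0, y) := by
    intro e y hy
    rw [hW₂d, hμ e, show Real.pi * y - c * y = c * y by rw [hpc]; ring, hV' _ _ hy, hΦ', hν, neg_zero]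
    have : 0 ≤ (Φ (e, 0, y)).2.2 := by
      rcases hy.eq_or_lt with rfl | hy
      · rw [h1 _ le_rfl]
      · exact (hΦpos _ hy).le
    generalize Φ (e, 0, y) = z at this ⊢
    obtain ⟨e', x', y'⟩ := z
    rw [hμ', hμ, max_eq_left this]
    simp
  have hneg : ∀ (e : E) y, y ≤ 0 → W₁ (e, c * y, y) = (e, c * y, y) := fun e y hy =>
    hW₁ _ (mul_nonpos_of_nonneg_of_nonpos hc.le hy)
  have hneg' : ∀ (e : E) y, y ≤ 0 → W₂ (e, c * y, y) = (e, c * y, y) := fun e y hy =>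
    hW₂ _ (by simp only; rw [hpc]; nlinarith)
  have s₁ := sides_of_carry h1 hc hW₁' hneg (Or.inl (hW₁ _ (by simp only; linarith)))
  have s₂ := sides_of_carry h1 hc hW₂' hneg' (Or.inr (hW₂ _ (by simp only; linarith)))
  have h0 : ∀ x : E × ℝ × ℝ, x.2.1 - c * x.2.2 = 0 → W₁ x = W₂ x := by
    rintro ⟨e, x, y⟩ hx
    obtain rfl : x = c * y := sub_eq_zero.1 hx
    rcases le_total 0 y with hy | hy
    · rw [hW₁' e y hy, hW₂' e y hy]
    · rw [hneg e y hy, hneg' e y hy]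
  obtain ⟨h, hh1, hh2⟩ := exists_paste W₁ W₂ (u := fun x => x.2.1 - c * x.2.2)
    (v := fun x => (Φ.symm x).2.1 - c * min (Φ.symm x).2.2 0) (by fun_prop) (by fun_prop)
    (fun x => by rw [← not_lt, (s₁ x).2, not_lt]) (fun x => (s₂ x).2) h0 (fun y hy => by
      obtain ⟨x, rfl⟩ := W₁.surjective y
      have : x.2.1 - c * x.2.2 = 0 :=
        le_antisymm (not_lt.1 (mt (s₁ x).2.1 hy.not_gt)) (not_lt.1 (mt (s₁ x).1.1 hy.not_lt))
      rw [h0 x this, W₂.symm_apply_apply, ← h0 x this, W₁.symm_apply_apply])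
  refine ⟨h, fun p hp => ?_, fun e y hy => ?_⟩
  · rcases le_total (p.2.1 - c * p.2.2) 0 with hu | hu
    · rw [hh1 p hu]
      refine hW₁ p (not_lt.1 fun hx => hp ⟨hx, ?_⟩)
      rw [hpc]
      nlinarith
    · rw [hh2 p hu]
      refine hW₂ p (not_lt.1 fun hx => hp ⟨?_, hx⟩)
      rw [hpc] at hx
      nlinarith
  · rw [hh1 _ (by simp), hW₁' e y hy]

end Sector

section Descend

variable {E : Type*} [TopologicalSpace E]

/-- The chart from the sector `0 ≤ x ≤ π y` to the closed upper half-plane. -/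
noncomputable def sectorToPlane (g : ℝ ≃o ℝ) (p : E × ℝ × ℝ) : E × ℂ :=
  (p.1, (g.symm (max p.2.2 0) : ℝ) * Complex.exp ((p.2.1 / p.2.2 : ℝ) * I))

/-- The inverse of `sectorToPlane` on the closed upper half-plane. -/
noncomputable def planeToSector (g : ℝ ≃o ℝ) (p : E × ℂ) : E × ℝ × ℝ :=
  (p.1, g ‖p.2‖ * Real.arccos (p.2.re / ‖p.2‖), g ‖p.2‖)

lemma continuous_sectorToPlane {g : ℝ ≃o ℝ} (hg : g 0 = 0) :
    Continuous (sectorToPlane (E := E) g) := by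
  have hgs := g.symm.continuous
  have hg' := orderIso_symm_zero_of_zero hg
  refine continuous_fst.prodMk (continuous_iff_continuousAt.2 ?_)
  rintro ⟨e, x, y⟩
  by_cases hy : y = 0
  · subst hy
    have h0 : Tendsto (fun p : E × ℝ × ℝ => g.symm (max p.2.2 0)) (𝓝 (e, x, 0)) (𝓝 0) := by
      have : ContinuousAt (fun p : E × ℝ × ℝ => g.symm (max p.2.2 0)) (e, x, 0) := by fun_prop
      simpa [ContinuousAt, hg'] using this
    simp only [ContinuousAt, max_self, hg', Complex.ofReal_zero, zero_mul]
    refine tendsto_zero_iff_norm_tendsto_zero.2 ?_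
    simp only [norm_mul, Complex.norm_real, Complex.norm_exp_ofReal_mul_I, mul_one,
      Real.norm_eq_abs]
    simpa only [abs_zero] using h0.abs
  · have : ContinuousAt (fun p : E × ℝ × ℝ => p.2.1 / p.2.2) (e, x, y) :=
      ContinuousAt.div (by fun_prop) (by fun_prop) hy
    fun_prop

lemma continuous_planeToSector {g : ℝ ≃o ℝ} (hg : g 0 = 0) :
    Continuous (planeToSector (E := E) g) := by
  have hgc := g.continuous
  refine continuous_fst.prodMk (Continuous.prodMk (continuous_iff_continuousAt.2 ?_) (by fun_prop))
  rintro ⟨e, c⟩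
  by_cases hc : c = 0
  · subst hc
    have h0 : Tendsto (fun p : E × ℂ => |g ‖p.2‖| * Real.pi) (𝓝 (e, 0)) (𝓝 0) := by
      have : ContinuousAt (fun p : E × ℂ => |g ‖p.2‖| * Real.pi) (e, 0) := by fun_prop
      simpa [ContinuousAt, hg] using this
    simp only [ContinuousAt, norm_zero, hg, zero_mul]
    refine squeeze_zero_norm (fun p => ?_) h0
    rw [norm_mul, Real.norm_eq_abs, Real.norm_eq_abs, abs_of_nonneg (Real.arccos_nonneg _)]
    exact mul_le_mul_of_nonneg_left (Real.arccos_le_pi _) (abs_nonneg _)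
  · have : ContinuousAt (fun p : E × ℂ => p.2.re / ‖p.2‖) (e, c) :=
      ContinuousAt.div (Complex.continuous_re.comp continuous_snd).continuousAt (by fun_prop)
        (norm_ne_zero_iff.2 hc)
    have h2 := Real.continuous_arccos.continuousAt.comp this
    exact ContinuousAt.mul (by fun_prop) h2

lemma sectorToPlane_planeToSector {E : Type*} {g : ℝ ≃o ℝ} (hg : g 0 = 0) {p : E × ℂ}
    (hp : 0 ≤ p.2.im) : sectorToPlane g (planeToSector g p) = p := by
  obtain ⟨e, c⟩ := p
  by_cases hc : c = 0
  · simp [sectorToPlane, planeToSector, hc, hg, orderIso_symm_zero_of_zero hg]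
  · have h := orderIso_apply_pos_of_zero hg (norm_pos_iff.2 hc)
    simp only [sectorToPlane, planeToSector, mul_div_cancel_left₀ _ h.ne', max_eq_left h.le,
      OrderIso.symm_apply_apply]
    rw [← Complex.arg_of_im_nonneg_of_ne_zero hp hc, Complex.norm_mul_exp_arg_mul_I]

lemma planeToSector_sectorToPlane {E : Type*} {g : ℝ ≃o ℝ} (hg : g 0 = 0) {p : E × ℝ × ℝ}
    (hp : 0 ≤ p.2.1) (hp' : p.2.1 ≤ Real.pi * p.2.2) :
    planeToSector g (sectorToPlane g p) = p := by
  obtain ⟨e, x, y⟩ := p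
  simp only at hp hp'
  have hy : 0 ≤ y := by
    by_contra! h
    nlinarith [Real.pi_pos]
  rcases hy.eq_or_lt with rfl | hy
  · have : x = 0 := le_antisymm (by simpa using hp') hp
    simp [sectorToPlane, planeToSector, hg, orderIso_symm_zero_of_zero hg, this]
  · have h := orderIso_apply_pos_of_zero (orderIso_symm_zero_of_zero hg) hy
    have hx : x / y ≤ Real.pi := by rwa [div_le_iff₀ hy]
    have hn : ‖((g.symm y : ℝ) : ℂ) * Complex.exp ((x / y : ℝ) * I)‖ = g.symm y := by
      rw [norm_mul, Complex.norm_exp_ofReal_mul_I, Complex.norm_real, Real.norm_eq_abs,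
        abs_of_pos h, mul_one]
    simp only [sectorToPlane, planeToSector, max_eq_left hy.le, hn, Complex.re_ofReal_mul,
      Complex.exp_ofReal_mul_I_re, mul_div_cancel_left₀ _ h.ne', OrderIso.apply_symm_apply]
    rw [Real.arccos_cos (by positivity) hx, mul_div_cancel₀ _ hy.ne']

lemma sectorToPlane_im_nonneg {E : Type*} {g : ℝ ≃o ℝ} (hg : g 0 = 0) {p : E × ℝ × ℝ}
    (hp : 0 ≤ p.2.1) (hp' : p.2.1 ≤ Real.pi * p.2.2) : 0 ≤ (sectorToPlane g p).2.im := by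
  have hy : 0 ≤ p.2.2 := by
    by_contra! h
    nlinarith [Real.pi_pos]
  have h0 : 0 ≤ g.symm (max p.2.2 0) := by
    have := g.symm.monotone (le_max_right p.2.2 0)
    rwa [orderIso_symm_zero_of_zero hg] at this
  simp only [sectorToPlane, Complex.im_ofReal_mul, Complex.exp_ofReal_mul_I_im]
  refine mul_nonneg h0 (Real.sin_nonneg_of_nonneg_of_le_pi (by positivity) ?_)
  rcases hy.eq_or_lt with hy | hy
  · rw [← hy, div_zero]; exact Real.pi_pos.le
  · rwa [div_le_iff₀ hy]

lemma planeToSector_mem {E : Type*} {g : ℝ ≃o ℝ} (hg : g 0 = 0) (p : E × ℂ) :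
    0 ≤ (planeToSector g p).2.1 ∧ (planeToSector g p).2.1 ≤ Real.pi * (planeToSector g p).2.2 := by
  have h0 : 0 ≤ g ‖p.2‖ := by
    rw [← hg]
    exact g.monotone (norm_nonneg _)
  refine ⟨mul_nonneg h0 (Real.arccos_nonneg _), ?_⟩
  simp only [planeToSector]
  rw [mul_comm]
  exact mul_le_mul_of_nonneg_right (Real.arccos_le_pi _) h0

lemma planeToSector_boundary {E : Type*} {g : ℝ ≃o ℝ} (hg : g 0 = 0) {p : E × ℂ}
    (hp : p.2.im = 0) : ¬ (0 < (planeToSector g p).2.1 ∧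
      (planeToSector g p).2.1 < Real.pi * (planeToSector g p).2.2) := by
  obtain ⟨e, c⟩ := p
  simp only at hp
  by_cases hc : c = 0
  · simp [planeToSector, hc, hg]
  obtain ⟨r, rfl⟩ : ∃ r : ℝ, c = r := ⟨c.re, Complex.ext rfl hp⟩
  have hr : r ≠ 0 := by simpa using hc
  rintro ⟨h1, h2⟩
  simp only [planeToSector, Complex.norm_real, Complex.ofReal_re, Real.norm_eq_abs] at h1 h2
  rcases hr.lt_or_gt with h | h
  · rw [abs_of_neg h, div_neg, div_self hr, Real.arccos_neg, Real.arccos_one, sub_zero,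
      mul_comm] at h2
    exact lt_irrefl _ h2
  · rw [abs_of_pos h, div_self hr, Real.arccos_one, mul_zero] at h1
    exact lt_irrefl _ h1

lemma exists_descend {g : ℝ ≃o ℝ} (hg : g 0 = 0) {h : (E × ℝ × ℝ) ≃ₜ (E × ℝ × ℝ)}
    (hh : ∀ p, ¬ (0 < p.2.1 ∧ p.2.1 < Real.pi * p.2.2) → h p = p) :
    ∃ H : (E × ℂ) ≃ₜ (E × ℂ), (∀ p, p.2.im ≤ 0 → H p = p) ∧
      ∀ p, 0 ≤ p.2.im → H p = sectorToPlane g (h (planeToSector g p)) := by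
  have hsymm : ∀ p, ¬ (0 < p.2.1 ∧ p.2.1 < Real.pi * p.2.2) → h.symm p = p := fun p hp => by
    rw [h.symm_apply_eq, hh p hp]
  have mem : ∀ f : (E × ℝ × ℝ) ≃ₜ (E × ℝ × ℝ),
      (∀ p, ¬ (0 < p.2.1 ∧ p.2.1 < Real.pi * p.2.2) → f p = p) → ∀ p : E × ℝ × ℝ, 0 ≤ p.2.1 →
      p.2.1 ≤ Real.pi * p.2.2 → 0 ≤ (f p).2.1 ∧ (f p).2.1 ≤ Real.pi * (f p).2.2 := by
    intro f hf p hp hp'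
    by_cases h' : 0 < (f p).2.1 ∧ (f p).2.1 < Real.pi * (f p).2.2
    · exact ⟨h'.1.le, h'.2.le⟩
    · have := f.injective (hf _ h')
      rw [this]
      exact ⟨hp, hp'⟩
  let D : ((E × ℝ × ℝ) ≃ₜ (E × ℝ × ℝ)) → E × ℂ → E × ℂ := fun f p =>
    if 0 ≤ p.2.im then sectorToPlane g (f (planeToSector g p)) else p
  have bd : ∀ f : (E × ℝ × ℝ) ≃ₜ (E × ℝ × ℝ),
      (∀ p, ¬ (0 < p.2.1 ∧ p.2.1 < Real.pi * p.2.2) → f p = p) → ∀ p : E × ℂ, p.2.im = 0 →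
      sectorToPlane g (f (planeToSector g p)) = p := by
    intro f hf p hp
    rw [hf _ (planeToSector_boundary hg hp), sectorToPlane_planeToSector hg hp.ge]
  have hD : ∀ f : (E × ℝ × ℝ) ≃ₜ (E × ℝ × ℝ),
      (∀ p, ¬ (0 < p.2.1 ∧ p.2.1 < Real.pi * p.2.2) → f p = p) → Continuous (D f) := by
    intro f hf
    have h1 := continuous_sectorToPlane (E := E) hg
    have h2 := continuous_planeToSector (E := E) hg
    refine Continuous.if_le (by fun_prop) continuous_id continuous_const
      (Complex.continuous_im.comp continuous_snd) fun p hp => bd f hf p hp.symm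
  have inv : ∀ f : (E × ℝ × ℝ) ≃ₜ (E × ℝ × ℝ),
      (∀ p, ¬ (0 < p.2.1 ∧ p.2.1 < Real.pi * p.2.2) → f p = p) → ∀ p, D f.symm (D f p) = p := by
    intro f hf p
    simp only [D]
    split_ifs with h1 h2
    · obtain ⟨a, b⟩ := mem f hf _ (planeToSector_mem hg p).1 (planeToSector_mem hg p).2
      rw [planeToSector_sectorToPlane hg a b, f.symm_apply_apply,
        sectorToPlane_planeToSector hg h1]
    · obtain ⟨a, b⟩ := mem f hf _ (planeToSector_mem hg p).1 (planeToSector_mem hg p).2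
      exact absurd (sectorToPlane_im_nonneg hg a b) h2
    · rfl
  refine ⟨{ toFun := D h
            invFun := D h.symm
            left_inv := inv h hh
            right_inv := inv h.symm hsymm
            continuous_toFun := hD h hh
            continuous_invFun := hD h.symm hsymm }, fun p hp => ?_, fun p hp => if_pos hp⟩
  rcases hp.eq_or_lt with hp | hp
  · exact (if_pos hp.ge).trans (bd h hh p hp)
  · exact if_neg (not_le.2 hp)

end Descend

/-- A homeomorphism fixing `E × {0}` and sending the half-space of positive reals into the open
upper half-space can be modified on that half-space only, so as to agree with it there. -/
theorem exists_homeomorph_straightening {E : Type*} [NormedAddCommGroup E] [NormedSpace ℝ E]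
    [ProperSpace E] {Ψ : (E × ℂ) ≃ₜ (E × ℂ)} (hΨ : ∀ e, Ψ (e, 0) = (e, 0))
    (hpos : ∀ e (s : ℝ), 0 < s → 0 < (Ψ (e, (s : ℂ))).2.im) :
    ∃ h : (E × ℂ) ≃ₜ (E × ℂ), (∀ p, p.2.im ≤ 0 → h p = p) ∧
      ∀ e (s : ℝ), 0 < s → h (e, s * I) = Ψ (e, (s : ℂ)) := by
  obtain ⟨Ψ', h0, hΨ', Φ, hL, hL', heq, hstrip⟩ := exists_normalized_lift hΨ hpos
  obtain ⟨hs1, hs2⟩ := lift_half_strip heq hstrip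
  have h0' : ∀ e, Ψ'.symm (e, 0) = (e, 0) := fun e => by rw [Ψ'.symm_apply_eq, h0]
  have hC := abs_lift_im_sub_le heq hs1 hs2
  have hC' : ∀ p, |(Φ.symm p).2.im - p.2.im| ≤ 3 * Real.pi := fun p => by
    have := hC (Φ.symm p)
    rwa [Φ.apply_symm_apply, abs_sub_comm] at this
  obtain ⟨g, hg, hr, hr'⟩ := exists_radial_gauge Ψ' h0
  have t1 : IsTame g Φ := hL.isTame h0 Ψ'.continuous Φ.continuous hr hC
  have t2 : IsTame g Φ.symm := hL'.isTame h0' Ψ'.symm.continuous Φ.symm.continuous hr' hC'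
  obtain ⟨h, hh, hh'⟩ := exists_sector_homeomorph (Φ := hatHomeo hg Φ t1 t2)
    (fun p hp => hatMap_of_nonpos hp)
    (fun p hx hy => by
      change 0 < (hatMap g Φ p).2.1
      rw [hatMap_of_pos hy]
      exact mul_pos (orderIso_apply_pos_of_zero hg (Real.exp_pos _)) (hs1 _ (div_nonneg hx hy.le)))
    (fun p hx hy => by
      change (hatMap g Φ p).2.1 < Real.pi * (hatMap g Φ p).2.2
      rw [hatMap_of_pos hy, mul_comm]
      exact mul_lt_mul_of_pos_right (hs2 _ (div_nonpos_of_nonpos_of_nonneg hx hy.le))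
        (orderIso_apply_pos_of_zero hg (Real.exp_pos _)))
  obtain ⟨H, hH, hH'⟩ := exists_descend hg hh
  refine ⟨H, hH, fun e s hs => ?_⟩
  have hgs := orderIso_apply_pos_of_zero hg hs
  have hM : planeToSector g (e, (s : ℂ) * I) = (e, Real.pi / 2 * g s, g s) := by
    have : ‖(s : ℂ) * I‖ = s := by simp [abs_of_pos hs]
    simp only [planeToSector, this]
    simp [mul_comm]
  rw [hH' _ (by simpa using hs.le), hM, hh' _ _ hgs.le]
  change sectorToPlane g (hatMap g Φ (e, 0, g s)) = _
  rw [hatMap_of_pos hgs, ← hΨ' e s]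
  simp only [OrderIso.symm_apply_apply, zero_div]
  have hw : (⟨Real.log s, 0⟩ : ℂ) = (Real.log s : ℂ) := rfl
  have hexp : Complex.exp (Real.log s : ℂ) = s := by
    rw [← Complex.ofReal_exp, Real.exp_log hs]
  have hl := hL e (Real.log s : ℂ)
  rw [hexp] at hl
  rw [hw]
  have hgp := orderIso_apply_pos_of_zero hg (Real.exp_pos (Φ (e, (Real.log s : ℂ))).2.re)
  refine Prod.ext hl.1 ?_
  rw [← hl.2]
  simp only [sectorToPlane, max_eq_left hgp.le, OrderIso.symm_apply_apply,
    mul_div_cancel_left₀ _ hgp.ne']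
  rw [Complex.ofReal_exp, ← Complex.exp_add, Complex.re_add_im]

section Position

variable {E : Type*} [NormedAddCommGroup E] [NormedSpace ℝ E]

lemma forall_pos_or_forall_neg {w : E × ℝ → ℝ} (hw : Continuous w)
    (h0 : ∀ e s, 0 < s → w (e, s) ≠ 0) :
    (∀ e s, 0 < s → 0 < w (e, s)) ∨ ∀ e s, 0 < s → w (e, s) < 0 := by
  have hS : IsPreconnected {p : E × ℝ | 0 < p.2} :=
    (convex_halfSpace_gt (f := fun p : E × ℝ => p.2) ⟨fun _ _ => rfl, fun _ _ => rfl⟩ 0).isPreconnected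
  rcases (h0 0 1 one_pos).lt_or_gt with h | h
  · exact Or.inr fun e s hs => lt_zero_of_isPreconnected hS hw.continuousOn
      (fun p hp => h0 p.1 p.2 hp) (x₀ := (0, 1)) (by simp) h (e, s) hs
  · exact Or.inl fun e s hs => neg_lt_zero.1 <| lt_zero_of_isPreconnected hS hw.neg.continuousOn
      (fun p hp => neg_ne_zero.2 (h0 p.1 p.2 hp)) (x₀ := (0, 1)) (by simp) (neg_lt_zero.2 h) (e, s) hs

/-- Negation in the second factor. -/
noncomputable def negHomeo (E : Type*) [TopologicalSpace E] : (E × ℂ) ≃ₜ (E × ℂ) :=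
  (Homeomorph.refl E).prodCongr (Homeomorph.neg ℂ)

lemma negHomeo_apply {E : Type*} [TopologicalSpace E] (e : E) (c : ℂ) :
    negHomeo E (e, c) = (e, -c) := rfl

variable [ProperSpace E]

lemma exists_cross {Ψ : (E × ℂ) ≃ₜ (E × ℂ)} (hΨ : ∀ e, Ψ (e, 0) = (e, 0))
    (hpos : ∀ e (s : ℝ), 0 < s → 0 < (Ψ (e, (s : ℂ))).2.im)
    (hneg : ∀ e (s : ℝ), 0 < s → (Ψ (e, -(s : ℂ))).2.im < 0) :
    ∃ k : (E × ℂ) ≃ₜ (E × ℂ), (∀ e (s : ℝ), k (e, s) = (e, (s : ℂ))) ∧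
      ∀ e (s : ℝ), k (Ψ (e, s)) = (e, s * I) := by
  obtain ⟨h, h1, h2⟩ := exists_homeomorph_straightening hΨ hpos
  have h1' : ∀ p : E × ℂ, p.2.im ≤ 0 → h.symm p = p := fun p hp => by rw [h.symm_apply_eq, h1 p hp]
  obtain ⟨h', h3, h4⟩ := exists_homeomorph_straightening
    (Ψ := (negHomeo E).trans (Ψ.trans (h.symm.trans (negHomeo E))))
    (fun e => by
      simp only [Homeomorph.trans_apply, negHomeo_apply, neg_zero, hΨ]
      rw [h1' _ (by simp), negHomeo_apply, neg_zero])
    (fun e s hs => by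
      simp only [Homeomorph.trans_apply, negHomeo_apply]
      rw [h1' _ (hneg e s hs).le]
      exact neg_pos.2 (hneg e s hs))
  have h3' : ∀ p : E × ℂ, p.2.im ≤ 0 → h'.symm p = p := fun p hp => by
    rw [h'.symm_apply_eq, h3 p hp]
  refine ⟨h.symm.trans ((negHomeo E).trans (h'.symm.trans (negHomeo E))), fun e s => ?_,
    fun e s => ?_⟩
  · simp only [Homeomorph.trans_apply]
    rw [h1' _ (by simp), negHomeo_apply e (s : ℂ), h3' (e, -(s : ℂ)) (by simp), negHomeo_apply, neg_neg]
  · simp only [Homeomorph.trans_apply]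
    rcases lt_trichotomy s 0 with hs | rfl | hs
    · have := h4 e (-s) (neg_pos.2 hs)
      simp only [Homeomorph.trans_apply, negHomeo_apply, Complex.ofReal_neg, neg_neg] at this
      rw [← this, h'.symm_apply_apply, negHomeo_apply]
      simp
    · rw [Complex.ofReal_zero, hΨ, h1' _ (by simp), negHomeo_apply e 0, h3' (e, -0) (by simp),
        negHomeo_apply]
      simp
    · rw [← h2 e s hs, h.symm_apply_apply, negHomeo_apply e (s * I),
        h3' (e, -(s * I)) (by simp [hs.le]), negHomeo_apply, neg_neg]

/-- A piecewise linear homeomorphism opening the second quadrant to the upper half-plane. -/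
noncomputable def openQuadrant (E : Type*) [TopologicalSpace E] : (E × ℂ) ≃ₜ (E × ℂ) :=
  (Homeomorph.refl E).prodCongr
    { toFun := fun c => ((c.re + c.im : ℝ) : ℂ) + (min (-c.re) c.im : ℝ) * I
      invFun := fun c => ((min c.re 0 - c.im : ℝ) : ℂ) + (max c.re 0 + c.im : ℝ) * I
      left_inv := fun c => by
        refine Complex.ext ?_ ?_
        · simp
          rcases le_total (-c.re) c.im with h | h
          · rw [min_eq_left h, min_eq_right (by linarith)]; ring
          · rw [min_eq_right h, min_eq_left (by linarith)]; ring
        · simp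
          rcases le_total (-c.re) c.im with h | h
          · rw [min_eq_left h, max_eq_left (by linarith)]; ring
          · rw [min_eq_right h, max_eq_right (by linarith)]; ring
      right_inv := fun c => by
        refine Complex.ext ?_ ?_
        · simp
        · simp
          rcases le_total c.re 0 with h | h
          · rw [min_eq_left h, max_eq_right h, min_eq_right (by linarith)]; ring
          · rw [min_eq_right h, max_eq_left h, min_eq_left (by linarith)]; ring
      continuous_toFun := by fun_prop
      continuous_invFun := by fun_prop }

lemma openQuadrant_apply {E : Type*} [TopologicalSpace E] (e : E) (c : ℂ) :
    openQuadrant E (e, c) = (e, ((c.re + c.im : ℝ) : ℂ) + (min (-c.re) c.im : ℝ) * I) := rfl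

/-- A piecewise linear shear of the lower half-plane. -/
noncomputable def shearLower (E : Type*) [TopologicalSpace E] : (E × ℂ) ≃ₜ (E × ℂ) :=
  (Homeomorph.refl E).prodCongr
    { toFun := fun c => c + (min c.im 0 : ℝ)
      invFun := fun c => c - (min c.im 0 : ℝ)
      left_inv := fun c => by simp
      right_inv := fun c => by simp
      continuous_toFun := by fun_prop
      continuous_invFun := by fun_prop }

lemma shearLower_apply {E : Type*} [TopologicalSpace E] (e : E) (c : ℂ) :
    shearLower E (e, c) = (e, c + (min c.im 0 : ℝ)) := rfl

lemma exists_touch_aux {Ψ : (E × ℂ) ≃ₜ (E × ℂ)} (hΨ : ∀ e, Ψ (e, 0) = (e, 0))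
    (hpos : ∀ e (s : ℝ), 0 < s → Ψ (e, (s : ℂ)) = (e, s * I))
    (hneg : ∀ e (s : ℝ), 0 < s → 0 < (Ψ (e, -(s : ℂ))).2.im)
    (hneg' : ∀ e (s : ℝ), 0 < s → (Ψ (e, -(s : ℂ))).2.re < 0) :
    ∃ k : (E × ℂ) ≃ₜ (E × ℂ), ∀ e (s : ℝ), 0 ≤ s → k (Ψ (e, s)) = (e, (s : ℂ)) ∧
      k (Ψ (e, -s)) = (e, s * I) ∧ k (e, -s) = (e, -(s : ℂ)) ∧ k (e, s) = (e, -(s * I)) := by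
  obtain ⟨h, h1, h2⟩ := exists_homeomorph_straightening
    (Ψ := (negHomeo E).trans (Ψ.trans (openQuadrant E)))
    (fun e => by simp [negHomeo_apply, hΨ, openQuadrant_apply])
    (fun e s hs => by
      simp only [Homeomorph.trans_apply, negHomeo_apply]
      change 0 < (openQuadrant E ((Ψ (e, -(s : ℂ))).1, (Ψ (e, -(s : ℂ))).2)).2.im
      rw [openQuadrant_apply]
      simpa using ⟨hneg' e s hs, hneg e s hs⟩)
  have h1' : ∀ p : E × ℂ, p.2.im ≤ 0 → h.symm p = p := fun p hp => by rw [h.symm_apply_eq, h1 p hp]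
  refine ⟨(openQuadrant E).trans (h.symm.trans (shearLower E)), fun e s hs => ⟨?_, ?_, ?_, ?_⟩⟩ <;>
    simp only [Homeomorph.trans_apply]
  · have : Ψ (e, (s : ℂ)) = (e, s * I) := by
      rcases hs.eq_or_lt with rfl | hs
      · simp [hΨ]
      · exact hpos e s hs
    rw [this, openQuadrant_apply, h1' _ (by simp), shearLower_apply]
    simp [hs]
  · have : h (e, s * I) = openQuadrant E (Ψ (e, -(s : ℂ))) := by
      rcases hs.eq_or_lt with rfl | hs
      · rw [h1 _ (by simp)]
        simp [hΨ, openQuadrant_apply]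
      · rw [h2 e s hs]; rfl
    rw [← this, h.symm_apply_apply, shearLower_apply]
    simp [hs]
  · rw [openQuadrant_apply, h1' _ (by simp), shearLower_apply]
    simp [hs]
  · rw [openQuadrant_apply, h1' _ (by simp), shearLower_apply]
    simp [hs]

lemma exists_touch {Ψ : (E × ℂ) ≃ₜ (E × ℂ)} (hΨ : ∀ e, Ψ (e, 0) = (e, 0))
    (hpos : ∀ e (s : ℝ), 0 < s → 0 < (Ψ (e, (s : ℂ))).2.im)
    (hneg : ∀ e (s : ℝ), 0 < s → 0 < (Ψ (e, -(s : ℂ))).2.im) :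
    ∃ k : (E × ℂ) ≃ₜ (E × ℂ), ∀ e (s : ℝ), 0 ≤ s → k (Ψ (e, s)) = (e, (s : ℂ)) ∧
      k (Ψ (e, -s)) = (e, s * I) ∧ ((k (e, -s) = (e, -(s : ℂ)) ∧ k (e, s) = (e, -(s * I))) ∨
      (k (e, s) = (e, -(s : ℂ)) ∧ k (e, -s) = (e, -(s * I)))) := by
  obtain ⟨h, h1, h2⟩ := exists_homeomorph_straightening hΨ hpos
  have h1' : ∀ p : E × ℂ, p.2.im ≤ 0 → h.symm p = p := fun p hp => by rw [h.symm_apply_eq, h1 p hp]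
  have him : ∀ p : E × ℂ, 0 < p.2.im → 0 < (h.symm p).2.im := by
    intro p hp
    by_contra! hn
    have := h1 _ hn
    rw [h.apply_symm_apply] at this
    rw [← this] at hn
    exact absurd hp hn.not_gt
  have hp2 : ∀ e (s : ℝ), 0 < s → h.symm (Ψ (e, (s : ℂ))) = (e, s * I) := fun e s hs => by
    rw [← h2 e s hs, h.symm_apply_apply]
  have hn2 : ∀ e (s : ℝ), 0 < s → 0 < (h.symm (Ψ (e, -(s : ℂ)))).2.im :=
    fun e s hs => him _ (hneg e s hs)
  have hre : ∀ e (s : ℝ), 0 < s → (h.symm (Ψ (e, -(s : ℂ)))).2.re ≠ 0 := by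
    intro e s hs h0
    set q := h.symm (Ψ (e, -(s : ℂ))) with hq
    have hqi : q = h.symm (Ψ (q.1, (q.2.im : ℂ))) := by
      rw [hp2 _ _ (hn2 e s hs)]
      exact Prod.ext rfl (Complex.ext (by simpa using h0) (by simp [hq]))
    have := Ψ.injective (h.symm.injective (hq.symm.trans hqi))
    have h3 := congrArg (fun p : E × ℂ => p.2.re) this
    simp only [Complex.neg_re, Complex.ofReal_re] at h3
    have := hn2 e s hs
    rw [← hq] at this
    linarith
  rcases forall_pos_or_forall_neg (w := fun p : E × ℝ => (h.symm (Ψ (p.1, -(p.2 : ℂ)))).2.re)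
    (Complex.continuous_re.comp (by fun_prop)) hre with hr | hr
  · let ρ : (E × ℂ) ≃ₜ (E × ℂ) := (conjHomeo E).trans (negHomeo E)
    have hρ : ∀ p, ρ p = (p.1, -(starRingEnd ℂ) p.2) := fun p => rfl
    obtain ⟨k, hk⟩ := exists_touch_aux (Ψ := Ψ.trans (h.symm.trans ρ))
      (fun e => by
        simp only [Homeomorph.trans_apply, hΨ]
        rw [h1' _ (by simp), hρ]
        simp)
      (fun e s hs => by
        simp only [Homeomorph.trans_apply, hp2 e s hs, hρ]
        simp)
      (fun e s hs => by
        simp only [Homeomorph.trans_apply, hρ]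
        simpa using hn2 e s hs)
      (fun e s hs => by
        simp only [Homeomorph.trans_apply, hρ]
        simpa using hr e s hs)
    refine ⟨h.symm.trans (ρ.trans k), fun e s hs => ?_⟩
    obtain ⟨k1, k2, k3, k4⟩ := hk e s hs
    refine ⟨k1, k2, Or.inr ?_⟩
    simp only [Homeomorph.trans_apply]
    have e1 : ρ (e, (s : ℂ)) = (e, -(s : ℂ)) := by simp [hρ]
    have e2 : ρ (e, -(s : ℂ)) = (e, (s : ℂ)) := by simp [hρ]
    rw [h1' _ (by simp), h1' _ (by simp), e1, e2]
    exact ⟨k3, k4⟩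
  · obtain ⟨k, hk⟩ := exists_touch_aux (Ψ := Ψ.trans h.symm)
      (fun e => by
        simp only [Homeomorph.trans_apply, hΨ]
        rw [h1' _ (by simp)])
      hp2 hn2 hr
    refine ⟨h.symm.trans k, fun e s hs => ?_⟩
    obtain ⟨k1, k2, k3, k4⟩ := hk e s hs
    refine ⟨k1, k2, Or.inl ?_⟩
    simp only [Homeomorph.trans_apply]
    rw [h1' _ (by simp), h1' _ (by simp)]
    exact ⟨k3, k4⟩

end Position

section Assembly

section Pair

lemma image_homeomorph_trans {X Y Z : Type*} [TopologicalSpace X] [TopologicalSpace Y]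
    [TopologicalSpace Z] (f : X ≃ₜ Y) (g : Y ≃ₜ Z) (S : Set X) : f.trans g '' S = g '' (f '' S) :=
  image_comp g f S

variable {E : Type*}

/-- The points of `E × ℂ` whose second coordinate is real. -/
def realSlice (E : Type*) : Set (E × ℂ) := {p | p.2.im = 0}

lemma mem_realSlice_iff {p : E × ℂ} : p ∈ realSlice E ↔ ∃ s : ℝ, p = (p.1, (s : ℂ)) :=
  ⟨fun h => ⟨p.2.re, Prod.ext rfl (Complex.ext rfl h)⟩, fun ⟨s, h⟩ => by
    rw [h]; exact Complex.ofReal_im s⟩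

lemma image_realSlice_of_cross {f : E × ℂ → E × ℂ} (hf : ∀ e (s : ℝ), f (e, s) = (e, s * I)) :
    f '' realSlice E = {p | p.2.re = 0} := by
  ext ⟨e, c⟩
  constructor
  · rintro ⟨p, hp, h⟩
    obtain ⟨s, hs⟩ := mem_realSlice_iff.1 hp
    rw [hs, hf] at h
    simp [← h]
  · intro h
    exact ⟨(e, (c.im : ℂ)), by simp [realSlice], by
      rw [hf]; exact Prod.ext rfl (Complex.ext (by simpa using h.symm) (by simp))⟩

lemma image_realSlice_of_touch {f : E × ℂ → E × ℂ} (hf : ∀ e (s : ℝ), 0 ≤ s →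
      f (e, s) = (e, (s : ℂ)) ∧ f (e, -s) = (e, s * I) ∨
      f (e, -s) = (e, (s : ℂ)) ∧ f (e, s) = (e, s * I)) :
    f '' realSlice E = {p | p.2.re * p.2.im = 0 ∧ 0 ≤ p.2.re ∧ 0 ≤ p.2.im} := by
  ext ⟨e, c⟩
  constructor
  · rintro ⟨p, hp, h⟩
    obtain ⟨s, hs⟩ := mem_realSlice_iff.1 hp
    rw [hs] at h
    rcases le_total 0 s with h0 | h0
    · rcases hf p.1 s h0 with ⟨h1, -⟩ | ⟨-, h1⟩ <;> rw [h1] at h <;> simp [← h, h0]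
    · have h2 := hf p.1 (-s) (neg_nonneg.2 h0)
      rw [Complex.ofReal_neg, neg_neg] at h2
      rcases h2 with ⟨-, h1⟩ | ⟨h1, -⟩ <;> rw [h1] at h <;> simp [← h, h0]
  · rintro ⟨h1, h2, h3⟩
    rcases mul_eq_zero.1 h1 with h | h
    · have hc : (e, c) = (e, (c.im : ℂ) * I) :=
        Prod.ext rfl (Complex.ext (by simpa using h) (by simp))
      rw [hc]
      rcases hf e c.im h3 with ⟨-, h4⟩ | ⟨-, h4⟩
      · exact ⟨_, by simp [realSlice], h4⟩
      · exact ⟨_, by simp [realSlice], h4⟩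
    · have hc : (e, c) = (e, (c.re : ℂ)) := Prod.ext rfl (Complex.ext rfl h)
      rw [hc]
      rcases hf e c.re h2 with ⟨h4, -⟩ | ⟨h4, -⟩
      · exact ⟨_, by simp [realSlice], h4⟩
      · exact ⟨_, by simp [realSlice], h4⟩

variable [NormedAddCommGroup E] [NormedSpace ℝ E] [ProperSpace E]

lemma exists_normalForm_of_pos {Ψ : (E × ℂ) ≃ₜ (E × ℂ)} (hΨ : ∀ e, Ψ (e, 0) = (e, 0))
    (hpos : ∀ e (s : ℝ), 0 < s → 0 < (Ψ (e, (s : ℂ))).2.im)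
    (hne : ∀ e (s : ℝ), 0 < s → (Ψ (e, -(s : ℂ))).2.im ≠ 0) :
    ∃ k : (E × ℂ) ≃ₜ (E × ℂ),
      k '' (Ψ '' realSlice E) = {p | p.2.re = 0} ∧ k '' realSlice E = {p | p.2.im = 0} ∨
      k '' (Ψ '' realSlice E) = {p | p.2.re * p.2.im = 0 ∧ 0 ≤ p.2.re ∧ 0 ≤ p.2.im} ∧
        k '' realSlice E = {p | p.2.re * p.2.im = 0 ∧ p.2.re ≤ 0 ∧ p.2.im ≤ 0} := by
  rcases forall_pos_or_forall_neg (w := fun p : E × ℝ => (Ψ (p.1, -(p.2 : ℂ))).2.im)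
    (Complex.continuous_im.comp (by fun_prop)) hne with hs | hs
  · obtain ⟨k, hk⟩ := exists_touch hΨ hpos hs
    refine ⟨k, Or.inr ⟨?_, ?_⟩⟩
    · rw [← image_comp]
      exact image_realSlice_of_touch fun e s h => Or.inl ⟨(hk e s h).1, (hk e s h).2.1⟩
    · have := image_realSlice_of_touch (f := negHomeo E ∘ k) fun e s h => by
        simp only [Function.comp_apply]
        rcases (hk e s h).2.2 with ⟨h1, h2⟩ | ⟨h1, h2⟩
        · exact Or.inr ⟨by rw [h1, negHomeo_apply, neg_neg], by rw [h2, negHomeo_apply, neg_neg]⟩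
        · exact Or.inl ⟨by rw [h1, negHomeo_apply, neg_neg], by rw [h2, negHomeo_apply, neg_neg]⟩
      ext p
      rw [← (negHomeo E).injective.mem_set_image, ← image_comp, this]
      change -p.2.re * -p.2.im = 0 ∧ 0 ≤ -p.2.re ∧ 0 ≤ -p.2.im ↔ _
      simp
  · obtain ⟨k, hk1, hk2⟩ := exists_cross hΨ hpos hs
    refine ⟨k, Or.inl ⟨?_, ?_⟩⟩
    · rw [← image_comp]
      exact image_realSlice_of_cross hk2
    · ext p
      constructor
      · rintro ⟨q, hq, rfl⟩
        obtain ⟨s, hs⟩ := mem_realSlice_iff.1 hq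
        rw [hs, hk1]
        exact Complex.ofReal_im s
      · intro hp
        obtain ⟨s, hs⟩ := mem_realSlice_iff.1 (show p ∈ realSlice E from hp)
        exact ⟨p, hp, by rw [hs, hk1]⟩

lemma exists_normalForm {Ψ : (E × ℂ) ≃ₜ (E × ℂ)} (hΨ : ∀ e, Ψ (e, 0) = (e, 0))
    (hne : ∀ e (s : ℝ), s ≠ 0 → (Ψ (e, (s : ℂ))).2.im ≠ 0) :
    ∃ k : (E × ℂ) ≃ₜ (E × ℂ),
      k '' (Ψ '' realSlice E) = {p | p.2.re = 0} ∧ k '' realSlice E = {p | p.2.im = 0} ∨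
      k '' (Ψ '' realSlice E) = {p | p.2.re * p.2.im = 0 ∧ 0 ≤ p.2.re ∧ 0 ≤ p.2.im} ∧
        k '' realSlice E = {p | p.2.re * p.2.im = 0 ∧ p.2.re ≤ 0 ∧ p.2.im ≤ 0} := by
  have hne' : ∀ e (s : ℝ), 0 < s → (Ψ (e, -(s : ℂ))).2.im ≠ 0 := fun e s hs => by
    simpa using hne e (-s) (neg_ne_zero.2 hs.ne')
  rcases forall_pos_or_forall_neg (w := fun p : E × ℝ => (Ψ (p.1, (p.2 : ℂ))).2.im)
    (Complex.continuous_im.comp (by fun_prop)) (fun e s hs => hne e s hs.ne') with hs | hs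
  · exact exists_normalForm_of_pos hΨ hs hne'
  · obtain ⟨k, hk⟩ := exists_normalForm_of_pos (Ψ := Ψ.trans (conjHomeo E))
      (fun e => by simp [hΨ, conjHomeo_apply])
      (fun e s h => by simpa [conjHomeo_apply] using hs e s h)
      (fun e s h => by simpa [conjHomeo_apply] using hne' e s h)
    have hr : conjHomeo E '' realSlice E = realSlice E := by
      have hfix : ∀ p ∈ realSlice E, conjHomeo E p = p := fun p hp =>
        Prod.ext rfl (Complex.conj_eq_iff_im.2 hp)
      ext p
      exact ⟨fun ⟨q, hq, h⟩ => by rwa [← h, hfix q hq], fun hp => ⟨p, hp, hfix p hp⟩⟩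
    refine ⟨(conjHomeo E).trans k, ?_⟩
    simpa only [image_homeomorph_trans, hr] using hk

end Pair

section Charts

/-- Separating off the zeroth coordinate. -/
def consHomeo (m : ℕ) : (ℝ × (Fin m → ℝ)) ≃ₜ (Fin (m + 1) → ℝ) where
  toFun p := Fin.cons p.1 p.2
  invFun x := (x 0, Fin.tail x)
  left_inv p := by simp
  right_inv x := by simp
  continuous_toFun := by fun_prop
  continuous_invFun := by unfold Fin.tail; fun_prop

/-- The complex coordinate gives the first two real coordinates. -/
noncomputable def planeHomeo (m : ℕ) : ((Fin m → ℝ) × ℂ) ≃ₜ (Fin (m + 2) → ℝ) where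
  toFun p := Fin.cons p.2.re (Fin.cons p.2.im p.1 : Fin (m + 1) → ℝ)
  invFun x := (fun i => x i.succ.succ, ⟨x 0, x 1⟩)
  left_inv p := rfl
  right_inv x := by
    ext i
    refine Fin.cases rfl (fun i => Fin.cases rfl (fun i => rfl) i) i
  continuous_toFun := by fun_prop
  continuous_invFun := by
    refine .prodMk (by fun_prop) ?_
    exact Complex.equivRealProdCLM.symm.continuous.comp
      (Continuous.prodMk (continuous_apply 0) (continuous_apply 1))

lemma mem_coordHyp_zero {m : ℕ} {x : Fin (m + 1) → ℝ} : x ∈ coordHyp (m + 1) 0 ↔ x 0 = 0 :=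
  ⟨fun h => h (Nat.succ_pos m), fun h _ => h⟩

lemma mem_coordHyp_one {m : ℕ} {x : Fin (m + 2) → ℝ} : x ∈ coordHyp (m + 2) 1 ↔ x 1 = 0 :=
  ⟨fun h => h (by omega), fun h _ => h⟩

lemma mem_Gplus {m : ℕ} {x : Fin (m + 2) → ℝ} :
    x ∈ Gplus (m + 2) ↔ x 0 * x 1 = 0 ∧ 0 ≤ x 0 ∧ 0 ≤ x 1 :=
  ⟨fun ⟨_, h⟩ => h, fun h => ⟨by omega, h⟩⟩

lemma mem_Gminus {m : ℕ} {x : Fin (m + 2) → ℝ} :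
    x ∈ Gminus (m + 2) ↔ x 0 * x 1 = 0 ∧ x 0 ≤ 0 ∧ x 1 ≤ 0 :=
  ⟨fun ⟨_, h⟩ => h, fun h => ⟨by omega, h⟩⟩

lemma Gplus_inter_Gminus (m : ℕ) :
    Gplus (m + 2) ∩ Gminus (m + 2) = coordHyp (m + 2) 0 ∩ coordHyp (m + 2) 1 := by
  ext x
  simp only [mem_inter_iff, mem_Gplus, mem_Gminus, mem_coordHyp_zero, mem_coordHyp_one]
  constructor
  · rintro ⟨⟨-, h1, h2⟩, -, h3, h4⟩
    exact ⟨le_antisymm h3 h1, le_antisymm h4 h2⟩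
  · rintro ⟨h1, h2⟩
    simp [h1, h2]

lemma image_planeHomeo {m : ℕ} {S : Set ((Fin m → ℝ) × ℂ)} {T : Set (Fin (m + 2) → ℝ)}
    (h : ∀ p, p ∈ S ↔ planeHomeo m p ∈ T) : planeHomeo m '' S = T := by
  ext x
  obtain ⟨p, rfl⟩ := (planeHomeo m).surjective x
  rw [(planeHomeo m).injective.mem_set_image, h]

lemma nonneg_of_homeomorph_pos {m : ℕ} {u : (Fin (m + 1) → ℝ) → ℝ} (hu : Continuous u)
    (h0 : ∀ y, u y = 0 → y 0 = 0) {p : Fin (m + 1) → ℝ} (hp : p 0 = 0) (hup : 0 < u p)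
    (y : Fin (m + 1) → ℝ) : 0 ≤ u y := by
  have key : ∀ y : Fin (m + 1) → ℝ, y 0 ≠ 0 → 0 ≤ u y := by
    intro y hy
    by_contra! hneg
    have hS : IsPreconnected {z : Fin (m + 1) → ℝ | 0 < z 0 * y 0} :=
      (convex_halfSpace_gt (f := fun z : Fin (m + 1) → ℝ => z 0 * y 0)
        ⟨fun _ _ => by simp [add_mul], fun _ _ => by simp [mul_assoc]⟩ 0).isPreconnected
    have hlt := lt_zero_of_isPreconnected hS hu.continuousOn
      (fun z (hz : 0 < z 0 * y 0) h => by simp [h0 z h] at hz) (x₀ := y) (mul_self_pos.2 hy) hneg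
    have ht : Tendsto (fun t : ℝ => u (p + t • y)) (𝓝[>] 0) (𝓝 (u (p + (0 : ℝ) • y))) :=
      (Continuous.tendsto (by fun_prop) 0).mono_left nhdsWithin_le_nhds
    rw [zero_smul, add_zero] at ht
    refine hup.not_ge (le_of_tendsto ht (eventually_mem_nhdsWithin.mono fun t (ht : 0 < t) => ?_))
    refine (hlt _ ?_).le
    have := mul_pos ht (mul_self_pos.2 hy)
    simpa [hp, mul_assoc] using this
  by_cases hy : y 0 = 0
  · have ht : Tendsto (fun t : ℝ => u (y + t • Pi.single 0 1)) (𝓝[>] 0)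
        (𝓝 (u (y + (0 : ℝ) • Pi.single 0 1))) :=
      (Continuous.tendsto (by fun_prop) 0).mono_left nhdsWithin_le_nhds
    rw [zero_smul, add_zero] at ht
    refine ge_of_tendsto ht (eventually_mem_nhdsWithin.mono fun t (ht : 0 < t) => key _ ?_)
    simpa [hy] using ht.ne'
  · exact key y hy

lemma IsTopoplane.eq_of_subset {m : ℕ} {H K : Set (Fin (m + 1) → ℝ)} (hH : IsTopoplane H)
    (hK : IsTopoplane K) (hHK : H ⊆ K) : H = K := by
  obtain ⟨e, he⟩ := hH
  obtain ⟨f, hf⟩ := hK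
  have hH : ∀ x, x ∈ H ↔ e x 0 = 0 := fun x => by
    rw [← mem_coordHyp_zero, ← he, e.injective.mem_set_image]
  have hK : ∀ x, x ∈ K ↔ f x 0 = 0 := fun x => by
    rw [← mem_coordHyp_zero, ← hf, f.injective.mem_set_image]
  refine hHK.antisymm fun p hp => ?_
  rw [hH]
  by_contra hne
  have hv : ∀ y, e (f.symm y) 0 = 0 → y 0 = 0 := fun y hy => by
    simpa using (hK _).1 (hHK ((hH _).2 hy))
  rcases lt_or_gt_of_ne hne with h | h
  · have := nonneg_of_homeomorph_pos (u := fun y => -(e (f.symm y) 0)) (by fun_prop)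
      (fun y hy => hv y (neg_eq_zero.1 hy)) ((hK p).1 hp) (by simpa using h)
      (f (e.symm fun _ => 1))
    norm_num at this
  · have := nonneg_of_homeomorph_pos (u := fun y => e (f.symm y) 0) (by fun_prop)
      hv ((hK p).1 hp) (by simpa using h) (f (e.symm fun _ => -1))
    norm_num at this

lemma exists_chart {m : ℕ} {H Z : Set (Fin (m + 2) → ℝ)} (hH : IsTopoplane H)
    (hZ : IsRelTopoplane H Z) :
    ∃ F : ((Fin m → ℝ) × ℂ) ≃ₜ (Fin (m + 2) → ℝ),
      (∀ p, F p ∈ H ↔ p.2.im = 0) ∧ ∀ p, F p ∈ Z ↔ p.2 = 0 := by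
  obtain ⟨e, he⟩ := hH
  obtain ⟨hZH, d, -, φ, hφ⟩ := hZ
  have hH : ∀ x, x ∈ H ↔ e x 0 = 0 := fun x => by
    rw [← mem_coordHyp_zero, ← he, e.injective.mem_set_image]
  let ψ : H ≃ₜ (Fin (m + 1) → ℝ) :=
    { toFun := fun x => Fin.tail (e x)
      invFun := fun y => ⟨e.symm (Fin.cons 0 y), by rw [hH]; simp⟩
      left_inv := fun x => by
        refine Subtype.ext ?_
        simp only
        rw [e.symm_apply_eq, ← (hH x).1 x.2, Fin.cons_self_tail]
      right_inv := fun y => by simp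
      continuous_toFun := by unfold Fin.tail; fun_prop
      continuous_invFun := by fun_prop }
  obtain rfl : d = m + 1 := eq_of_homeomorph_fin_fun (φ.symm.trans ψ)
  have hZφ : ∀ x : H, (x : Fin (m + 2) → ℝ) ∈ Z ↔ φ x 0 = 0 := fun x => by
    rw [← mem_coordHyp_zero, ← hφ, φ.injective.mem_set_image]
    rfl
  let S : ((Fin m → ℝ) × ℂ) ≃ₜ ℝ × (Fin (m + 1) → ℝ) :=
    (planeHomeo m).trans (((consHomeo (m + 1)).symm.trans
      ((Homeomorph.refl ℝ).prodCongr (consHomeo m).symm)).trans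
      ((Homeomorph.prodAssoc ℝ ℝ _).symm.trans
        (((Homeomorph.prodComm ℝ ℝ).prodCongr (Homeomorph.refl _)).trans
          ((Homeomorph.prodAssoc ℝ ℝ _).trans
            ((Homeomorph.refl ℝ).prodCongr (consHomeo m))))))
  have hS : ∀ p, S p = (p.2.im, Fin.cons p.2.re p.1) := fun p => rfl
  let F := S.trans (((Homeomorph.refl ℝ).prodCongr (φ.symm.trans ψ)).trans
    ((consHomeo (m + 1)).trans e.symm))
  have hF : ∀ p, F p = e.symm (Fin.cons p.2.im (ψ (φ.symm (Fin.cons p.2.re p.1)))) := fun p => rfl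
  have hFH : ∀ p, F p ∈ H ↔ p.2.im = 0 := fun p => by rw [hH, hF, e.apply_symm_apply, Fin.cons_zero]
  refine ⟨F, hFH, fun p => ?_⟩
  have hφF : ∀ h : F p ∈ H, φ ⟨F p, h⟩ = Fin.cons p.2.re p.1 := fun h => by
    rw [← φ.eq_symm_apply]
    refine ψ.injective ?_
    change Fin.tail (e (F p)) = _
    rw [hF, e.apply_symm_apply, Fin.tail_cons]
  constructor
  · intro h
    have h1 := (hZφ ⟨F p, hZH h⟩).1 h
    rw [hφF, Fin.cons_zero] at h1
    exact Complex.ext h1 ((hFH p).1 (hZH h))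
  · intro h
    have h1 : F p ∈ H := (hFH p).2 (by rw [h, Complex.zero_im])
    rw [hZφ ⟨F p, h1⟩, hφF, h]
    rfl

lemma exists_chart_pair {X E : Type*} [TopologicalSpace X] [TopologicalSpace E]
    {F F' : (E × ℂ) ≃ₜ X} (h : ∀ e, (F'.symm (F (e, 0))).2 = 0)
    (h' : ∀ e, (F.symm (F' (e, 0))).2 = 0) :
    ∃ κ : E ≃ₜ E, ∀ e, F' (κ e, 0) = F (e, 0) := by
  have h1 : ∀ e, ((F'.symm (F (e, 0))).1, (0 : ℂ)) = F'.symm (F (e, 0)) :=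
    fun e => Prod.ext rfl (h e).symm
  have h2 : ∀ e, ((F.symm (F' (e, 0))).1, (0 : ℂ)) = F.symm (F' (e, 0)) :=
    fun e => Prod.ext rfl (h' e).symm
  refine ⟨⟨⟨fun e => (F'.symm (F (e, 0))).1, fun e => (F.symm (F' (e, 0))).1, fun e => ?_,
    fun e => ?_⟩, by fun_prop, by fun_prop⟩, fun e => ?_⟩
  · simp [h1]
  · simp [h2]
  · change F' ((F'.symm (F (e, 0))).1, 0) = _
    simp [h1]

end Charts

lemma IsArrangement.isRelTopoplane_inter {m : ℕ} {𝓗 : Set (Set (Fin (m + 1) → ℝ))}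
    (h𝓗 : IsArrangement 𝓗) {H K : Set (Fin (m + 1) → ℝ)} (hH : H ∈ 𝓗) (hK : K ∈ 𝓗)
    (hne : H ≠ K) (hmeet : (H ∩ K).Nonempty) : IsRelTopoplane K (H ∩ K) := by
  rcases h𝓗.2.2 H hH K ⟨⟨{K}, by simpa using hK, by simp⟩, hmeet.right⟩ with h | h | h
  · exact absurd ((h𝓗.2.1 K hK).eq_of_subset (h𝓗.2.1 H hH) h).symm hne
  · exact absurd h hmeet.ne_empty
  · exact h

end Assembly

theorem statement2 {n : ℕ} (hn : 2 ≤ n) (𝓗 : Set (Set (Fin n → ℝ)))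
    (h𝓗 : IsArrangement 𝓗) (H₁ H₂ : Set (Fin n → ℝ))
    (h₁ : H₁ ∈ 𝓗) (h₂ : H₂ ∈ 𝓗) (hne : H₁ ≠ H₂)
    (hmeet : (H₁ ∩ H₂).Nonempty) (hnc : ¬Crosses H₁ H₂) :
    ∃ e : (Fin n → ℝ) ≃ₜ (Fin n → ℝ), e '' H₁ = Gplus n ∧ e '' H₂ = Gminus n ∧
      e '' (H₁ ∩ H₂) = coordHyp n 0 ∩ coordHyp n 1 := by
  obtain ⟨m, rfl⟩ : ∃ m, n = m + 2 := ⟨n - 2, by omega⟩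
  obtain ⟨F, hF, hFZ⟩ := exists_chart (h𝓗.2.1 H₁ h₁)
    (h𝓗.isRelTopoplane_inter h₂ h₁ hne.symm (by rwa [inter_comm]))
  rw [inter_comm] at hFZ
  obtain ⟨F', hF', hFZ'⟩ := exists_chart (h𝓗.2.1 H₂ h₂) (h𝓗.isRelTopoplane_inter h₁ h₂ hne hmeet)
  obtain ⟨κ, hκ⟩ := exists_chart_pair (F := F) (F' := F')
    (fun e => by rw [← hFZ', F'.apply_symm_apply, hFZ])
    (fun e => by rw [← hFZ, F.apply_symm_apply, hFZ'])
  let G : ((Fin m → ℝ) × ℂ) ≃ₜ (Fin (m + 2) → ℝ) := (κ.prodCongr (Homeomorph.refl ℂ)).trans F'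
  have hG : ∀ p, G p ∈ H₂ ↔ p.2.im = 0 := fun p => hF' _
  have hH₁ : F '' realSlice _ = H₁ := by
    ext x
    obtain ⟨p, rfl⟩ := F.surjective x
    rw [F.injective.mem_set_image, hF]
    rfl
  have hH₂ : G '' realSlice _ = H₂ := by
    ext x
    obtain ⟨p, rfl⟩ := G.surjective x
    rw [G.injective.mem_set_image, hG]
    rfl
  obtain ⟨k, hk⟩ := exists_normalForm (Ψ := F.trans G.symm)
    (fun e => by
      rw [Homeomorph.trans_apply, G.symm_apply_eq]
      exact (hκ e).symm)
    (fun e s hs h => by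
      rw [Homeomorph.trans_apply, ← hG, G.apply_symm_apply] at h
      have h1 := (hFZ (e, (s : ℂ))).1 ⟨(hF _).2 (Complex.ofReal_im s), h⟩
      exact hs (Complex.ofReal_eq_zero.1 h1))
  rw [image_homeomorph_trans, hH₁] at hk
  let T := G.symm.trans (k.trans (planeHomeo m))
  have hT₁ : T '' H₁ = planeHomeo m '' (k '' (G.symm '' H₁)) := by
    simp only [T, image_homeomorph_trans]
  have hT₂ : T '' H₂ = planeHomeo m '' (k '' realSlice _) := by
    simp only [T, image_homeomorph_trans]
    rw [← hH₂, ← image_comp G.symm, G.symm_comp_self, image_id]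
  rcases hk with ⟨hk₁, hk₂⟩ | ⟨hk₁, hk₂⟩
  · refine absurd ⟨T, ?_, ?_⟩ hnc
    · rw [hT₁, hk₁]
      exact image_planeHomeo fun p => by rw [mem_coordHyp_zero]; rfl
    · rw [hT₂, hk₂]
      exact image_planeHomeo fun p => by rw [mem_coordHyp_one]; rfl
  · have h1 : T '' H₁ = Gplus (m + 2) := by
      rw [hT₁, hk₁]
      exact image_planeHomeo fun p => by rw [mem_Gplus]; rfl
    have h2 : T '' H₂ = Gminus (m + 2) := by
      rw [hT₂, hk₂]
      exact image_planeHomeo fun p => by rw [mem_Gminus]; rfl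
    exact ⟨T, h1, h2, by rw [image_inter T.injective, h1, h2, Gplus_inter_Gminus]⟩
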